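/- For every real α > 0 and every ε > 0 there exists x₀ such that for all real x ≥ x₀, S(x) ≥ (1 − ε) · (x / log x) · (log log x)^α. -/

import Mathlib

/-- A Hadamard matrix of order `n`: an `n × n` real matrix with entries in `{-1, +1}`
satisfying `H * Hᵀ = n • I`. -/
def IsHadamardMatrix {n : ℕ} (H : Matrix (Fin n) (Fin n) ℝ) : Prop :=
  (∀ i j, H i j = 1 ∨ H i j = -1) ∧ H * H.transpose = (n : ℝ) • 1

/-- There exists a Hadamard matrix of order `n`. -/
def HadamardOrder (n : ℕ) : Prop :=
  ∃ H : Matrix (Fin n) (Fin n) ℝ, IsHadamardMatrix H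


/-- `S x` is the number of positive integers `n ≤ x` for which a Hadamard matrix
of order `n` exists. -/
noncomputable def S (x : ℝ) : ℕ :=
  {n : ℕ | 0 < n ∧ (n : ℝ) ≤ x ∧ HadamardOrder n}.ncard

open Matrix in
theorem hadamardOrder_of_matrix {ι : Type*} [Fintype ι] [DecidableEq ι] (A : Matrix ι ι ℝ)
    (h : ∀ i j, A i j = 1 ∨ A i j = -1) (hA : A * Aᵀ = (Fintype.card ι : ℝ) • 1) :
    HadamardOrder (Fintype.card ι) := by
  let e := Fintype.equivFin ι
  refine ⟨A.submatrix e.symm e.symm, fun i j => h _ _, ?_⟩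
  rw [transpose_submatrix, submatrix_mul_equiv, hA, submatrix_smul]
  simp

open Matrix in
open scoped Kronecker in
theorem HadamardOrder.mul {m n : ℕ} (hm : HadamardOrder m) (hn : HadamardOrder n) :
    HadamardOrder (m * n) := by
  obtain ⟨A, hA, hA'⟩ := hm
  obtain ⟨B, hB, hB'⟩ := hn
  have := hadamardOrder_of_matrix (A ⊗ₖ B) (fun i j => by
    rcases hA i.1 j.1 with h | h <;> rcases hB i.2 j.2 with h' | h' <;>
      simp [kroneckerMap_apply, h, h']) (by
    rw [show (A ⊗ₖ B)ᵀ = Aᵀ ⊗ₖ Bᵀ from rfl, ← mul_kronecker_mul, hA', hB',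
      smul_kronecker, kronecker_smul, one_kronecker_one, smul_smul]
    simp)
  simpa using this

theorem hadamardOrder_one : HadamardOrder 1 :=
  ⟨Matrix.of fun _ _ => 1, by simp, by
    ext i j
    simp [Subsingleton.elim i j, Matrix.mul_apply]⟩

open Matrix in
theorem hadamardOrder_two : HadamardOrder 2 := by
  refine ⟨!![1, 1; 1, -1], fun i j => by fin_cases i <;> fin_cases j <;> simp, ?_⟩
  ext i j
  fin_cases i <;> fin_cases j <;> norm_num [mul_apply, Fin.sum_univ_two]

section Paley

open Matrix

variable (p : ℕ) [Fact p.Prime]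

theorem sum_quadraticChar_mul_add (hp : p ≠ 2) {c : ZMod p} (hc : c ≠ 0) :
    ∑ x, quadraticChar (ZMod p) x * quadraticChar (ZMod p) (x + c) = -1 := by
  have hF : ringChar (ZMod p) ≠ 2 := by rwa [ZMod.ringChar_zmod_n]
  set χ := quadraticChar (ZMod p) with hχ
  have h1 := jacobiSum_nontrivial_inv (quadraticChar_ne_one hF)
  rw [(quadraticChar_isQuadratic _).inv, jacobiSum, ← hχ] at h1
  have h2 : ∑ x, χ x * χ (x + c) = ∑ x, χ (-c * x) * χ (-c * x + c) := by
    refine (Fintype.sum_equiv (Equiv.mulLeft₀ (-c) (neg_ne_zero.2 hc)) _ _ fun x => ?_).symm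
    simp
  have h3 : ∀ x, χ (-c * x) * χ (-c * x + c) = χ (-1) * (χ x * χ (1 - x)) := fun x => by
    have : -c * x + c = c * (1 - x) := by ring
    rw [this, show -c * x = -1 * c * x by ring, map_mul, map_mul, map_mul]
    have : χ c ^ 2 = 1 := quadraticChar_sq_one hc
    linear_combination (χ (-1) * χ x * χ (1 - x)) * this
  have h4 : χ (-1) ^ 2 = 1 := quadraticChar_sq_one (neg_ne_zero.2 one_ne_zero)
  simp_rw [h2, h3, ← Finset.mul_sum]
  rw [h1]
  linear_combination -h4

/-- The Paley conference matrix of order `p + 1`. -/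
def paleyConference : Matrix (Option (ZMod p)) (Option (ZMod p)) ℝ
  | none, none => 0
  | none, some _ => 1
  | some _, none => (quadraticChar (ZMod p) (-1) : ℤ)
  | some i, some j => (quadraticChar (ZMod p) (i - j) : ℤ)

theorem paleyConference_mul_transpose (hp : p ≠ 2) :
    paleyConference p * (paleyConference p)ᵀ = (p : ℝ) • 1 := by
  have hF : ringChar (ZMod p) ≠ 2 := by rwa [ZMod.ringChar_zmod_n]
  have h4 : quadraticChar (ZMod p) (-1) ^ 2 = 1 :=
    quadraticChar_sq_one (neg_ne_zero.2 one_ne_zero)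
  have h0 : ∀ i, ∑ x, quadraticChar (ZMod p) (i - x) = 0 := fun i => by
    rw [← quadraticChar_sum_zero hF]
    exact Fintype.sum_equiv (Equiv.subLeft i) _ _ fun x => by simp
  have hsq : ∀ i, ∑ x, quadraticChar (ZMod p) (i - x) * quadraticChar (ZMod p) (i - x) = p - 1 :=
      fun i => by
    have : ∑ x, quadraticChar (ZMod p) (i - x) * quadraticChar (ZMod p) (i - x) =
        ∑ x, quadraticChar (ZMod p) x * quadraticChar (ZMod p) x :=
      Fintype.sum_equiv (Equiv.subLeft i) _ _ fun x => by simp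
    rw [this, ← Finset.add_sum_erase _ _ (Finset.mem_univ 0),
      Finset.sum_congr rfl (g := fun _ => 1)
        fun x hx => by rw [← sq]; exact quadraticChar_sq_one (Finset.ne_of_mem_erase hx)]
    have := (Fact.out : p.Prime).one_lt
    simp [Finset.card_erase_of_mem, ZMod.card, Nat.cast_sub this.le]
  ext (_ | i) (_ | j)
  · simp [mul_apply, Fintype.sum_option, paleyConference, ZMod.card]
  · have := h0 j
    simp [mul_apply, Fintype.sum_option, paleyConference]
    exact_mod_cast this
  · have := h0 i
    simp [mul_apply, Fintype.sum_option, paleyConference]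
    exact_mod_cast this
  · simp only [mul_apply, Fintype.sum_option, paleyConference, transpose_apply, Matrix.smul_apply]
    by_cases hij : i = j
    · subst hij
      simp only [one_apply_eq, smul_eq_mul, mul_one]
      have := hsq i
      have h5 : quadraticChar (ZMod p) (-1) * quadraticChar (ZMod p) (-1) +
        ∑ x, quadraticChar (ZMod p) (i - x) * quadraticChar (ZMod p) (i - x) = p := by
        rw [this, ← sq, h4]; ring
      exact_mod_cast h5
    · rw [one_apply_ne (by simpa using hij), smul_zero]
      have h6 : ∑ x, quadraticChar (ZMod p) (i - x) * quadraticChar (ZMod p) (j - x) = -1 := by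
        rw [← sum_quadraticChar_mul_add p hp (sub_ne_zero.2 (Ne.symm hij))]
        exact Fintype.sum_equiv (Equiv.subLeft i) _ _ fun x => by simp
      have h5 : quadraticChar (ZMod p) (-1) * quadraticChar (ZMod p) (-1) +
        ∑ x, quadraticChar (ZMod p) (i - x) * quadraticChar (ZMod p) (j - x) = 0 := by
        rw [h6, ← sq, h4]; ring
      exact_mod_cast h5

theorem paleyConference_transpose :
    (paleyConference p)ᵀ = ((quadraticChar (ZMod p) (-1) : ℤ) : ℝ) • paleyConference p := by
  have h4 : quadraticChar (ZMod p) (-1) * quadraticChar (ZMod p) (-1) = 1 := by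
    rw [← sq]; exact quadraticChar_sq_one (neg_ne_zero.2 one_ne_zero)
  ext (_ | i) (_ | j)
  · simp [paleyConference]
  · simp [paleyConference]
  · simp only [paleyConference, transpose_apply, Matrix.smul_apply, smul_eq_mul]
    exact_mod_cast h4.symm
  · simp only [paleyConference, transpose_apply, Matrix.smul_apply, smul_eq_mul]
    rw [show j - i = -1 * (i - j) by ring, map_mul]
    push_cast; rfl

theorem paleyConference_apply (i j : Option (ZMod p)) :
    (i = j ∧ paleyConference p i j = 0) ∨
      (i ≠ j ∧ (paleyConference p i j = 1 ∨ paleyConference p i j = -1)) := by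
  have key : ∀ x : ZMod p, x ≠ 0 → ((quadraticChar (ZMod p) x : ℤ) : ℝ) = 1 ∨
      ((quadraticChar (ZMod p) x : ℤ) : ℝ) = -1 := fun x hx => by
    rcases quadraticChar_dichotomy hx with h | h <;> simp [h]
  rcases i with _ | i <;> rcases j with _ | j
  · simp [paleyConference]
  · simp [paleyConference]
  · exact Or.inr ⟨by simp, key _ (neg_ne_zero.2 one_ne_zero)⟩
  · by_cases hij : i = j
    · simp [hij, paleyConference]
    · exact Or.inr ⟨by simpa using hij, key _ (sub_ne_zero.2 hij)⟩

theorem hadamardOrder_two_mul_prime_add_one (hp : p ≠ 2) : HadamardOrder (2 * (p + 1)) := by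
  have hC := paleyConference_mul_transpose p hp
  have hT := paleyConference_transpose p
  have happ := paleyConference_apply p
  set C := paleyConference p
  have hplus : ∀ i j, (C + 1) i j = 1 ∨ (C + 1) i j = -1 := fun i j => by
    rcases happ i j with ⟨rfl, h⟩ | ⟨hne, h⟩
    · simp [h]
    · simpa [one_apply_ne hne] using h
  have hminus : ∀ i j, (C - 1) i j = 1 ∨ (C - 1) i j = -1 := fun i j => by
    rcases happ i j with ⟨rfl, h⟩ | ⟨hne, h⟩
    · simp [h]
    · simpa [one_apply_ne hne] using h
  rcases quadraticChar_dichotomy (F := ZMod p) (neg_ne_zero.2 one_ne_zero) with h | h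
  · rw [h] at hT
    simp only [Int.cast_one, one_smul] at hT
    rw [hT] at hC
    have := hadamardOrder_of_matrix (fromBlocks (C + 1) (C - 1) (C - 1) (-(C + 1))) (by
      rintro (i | i) (j | j)
      · exact hplus i j
      · exact hminus i j
      · exact hminus i j
      · change -((C + 1) i j) = 1 ∨ -((C + 1) i j) = -1
        rcases hplus i j with h | h <;> simp only [h, neg_neg, or_true, true_or]) (by
      rw [fromBlocks_transpose, fromBlocks_multiply]
      simp only [transpose_add, transpose_sub, transpose_neg, transpose_one, hT]
      rw [← fromBlocks_one, fromBlocks_smul]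
      have e1 : (C + 1) * (C + 1) + (C - 1) * (C - 1) = (2 * (p + 1) : ℝ) • 1 := by
        have : (C + 1) * (C + 1) + (C - 1) * (C - 1) = (2 : ℝ) • (C * C) + (2 : ℝ) • 1 := by
          rw [two_smul, two_smul]; noncomm_ring
        rw [this, hC, smul_smul, ← add_smul]; congr 1; ring
      have hcard : ((Fintype.card (Option (ZMod p) ⊕ Option (ZMod p)) : ℕ) : ℝ) =
          2 * (p + 1) := by
        simp [ZMod.card]; ring
      rw [hcard]
      congr 1
      · rw [smul_zero]; noncomm_ring
      · rw [smul_zero]; noncomm_ring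
      · rw [← e1]; noncomm_ring)
    convert this using 1
    simp [ZMod.card]; ring
  · rw [h] at hT
    simp only [Int.cast_neg, Int.cast_one, neg_smul, one_smul] at hT
    refine hadamardOrder_two.mul ?_
    have := hadamardOrder_of_matrix (C + 1) hplus (by
      simp only [transpose_add, transpose_one]
      rw [mul_add, add_mul, hC, hT]
      simp [ZMod.card, add_smul])
    convert this using 1
    simp [ZMod.card]

end Paley

theorem Function.Periodic.abs_sum_range_le {f : ℕ → ℝ} {n : ℕ} (hf : Function.Periodic f n)
    (h0 : ∑ t ∈ Finset.range n, f t = 0) (h1 : ∀ t, |f t| ≤ 1) (hn : 0 < n) (T : ℕ) :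
    |∑ t ∈ Finset.range T, f t| ≤ n := by
  induction T using Nat.strong_induction_on with
  | _ T ih =>
    rcases lt_or_ge T n with h | h
    · calc |∑ t ∈ Finset.range T, f t| ≤ ∑ t ∈ Finset.range T, |f t| :=
            Finset.abs_sum_le_sum_abs _ _
        _ ≤ ∑ t ∈ Finset.range T, 1 := Finset.sum_le_sum fun t _ => h1 t
        _ = T := by simp
        _ ≤ n := by exact_mod_cast h.le
    · obtain ⟨k, rfl⟩ := Nat.exists_eq_add_of_le h
      rw [Finset.sum_range_add, h0, zero_add]
      simp_rw [fun t => (add_comm n t), hf _]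
      exact ih k (by omega)

theorem Function.Periodic.sum_range_le {f : ℕ → ℝ} {n : ℕ} (hf : Function.Periodic f n)
    {c : ℝ} (hc : ∑ t ∈ Finset.range n, f t ≤ n * c) (h0 : ∀ t, 0 ≤ f t) (hn : 0 < n) (T : ℕ) :
    ∑ t ∈ Finset.range T, f t ≤ (T + n) * c := by
  have hc0 : 0 ≤ c := by
    have : (0 : ℝ) ≤ n * c := le_trans (Finset.sum_nonneg fun t _ => h0 t) hc
    exact nonneg_of_mul_nonneg_right this (by exact_mod_cast hn)
  induction T using Nat.strong_induction_on with
  | _ T ih =>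
    rcases lt_or_ge T n with h | h
    · calc ∑ t ∈ Finset.range T, f t ≤ ∑ t ∈ Finset.range n, f t :=
            Finset.sum_le_sum_of_subset_of_nonneg (by simpa using h.le) fun t _ _ => h0 t
        _ ≤ n * c := hc
        _ ≤ (T + n) * c := by gcongr; simp
    · obtain ⟨k, rfl⟩ := Nat.exists_eq_add_of_le h
      rw [Finset.sum_range_add]
      simp_rw [fun t => (add_comm n t), hf _]
      have := ih k (by omega)
      push_cast
      linarith

theorem sum_range_mul_of_coprime {f h : ℕ → ℝ} {m n : ℕ} (hf : Function.Periodic f m)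
    (hh : Function.Periodic h n) (hm : 0 < m) (hn : 0 < n) (hmn : m.Coprime n) :
    ∑ t ∈ Finset.range (m * n), f t * h t =
      (∑ t ∈ Finset.range m, f t) * ∑ t ∈ Finset.range n, h t := by
  rw [Finset.sum_mul_sum, ← Finset.sum_product']
  refine Finset.sum_bij (fun t _ => (t % m, t % n)) ?_ ?_ ?_ ?_
  · intro t _
    simp [Nat.mod_lt _ hm, Nat.mod_lt _ hn]
  · intro s hs t ht hst
    simp only [Prod.mk.injEq] at hst
    have : s ≡ t [MOD m * n] := (Nat.modEq_and_modEq_iff_modEq_mul hmn).1 hst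
    exact this.eq_of_lt_of_lt (Finset.mem_range.1 hs) (Finset.mem_range.1 ht)
  · rintro ⟨i, j⟩ hij
    simp only [Finset.mem_product, Finset.mem_range] at hij
    refine ⟨Nat.chineseRemainder hmn i j, ?_, ?_⟩
    · simpa using Nat.chineseRemainder_lt_mul hmn i j hm.ne' hn.ne'
    · have := (Nat.chineseRemainder hmn i j).2
      exact Prod.ext (Eq.trans this.1 (Nat.mod_eq_of_lt hij.1)) (Eq.trans this.2 (Nat.mod_eq_of_lt hij.2))
  · intro t _
    simp only [hf.map_mod_nat, hh.map_mod_nat]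

/-- The product of `v p t` over the primes `p` dividing `d`. -/
noncomputable def primeProd (v : ℕ → ℕ → ℝ) (d t : ℕ) : ℝ := ∏ p ∈ d.primeFactors, v p t

theorem primeProd_mul (v : ℕ → ℕ → ℝ) {m n : ℕ} (h : m.Coprime n) (t : ℕ) :
    primeProd v (m * n) t = primeProd v m t * primeProd v n t := by
  rw [primeProd, h.primeFactors_mul, Finset.prod_union h.disjoint_primeFactors]
  rfl

theorem primeProd_prime (v : ℕ → ℕ → ℝ) {p : ℕ} (hp : p.Prime) (t : ℕ) :
    primeProd v p t = v p t := by
  simp [primeProd, hp.primeFactors]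

theorem periodic_primeProd {v : ℕ → ℕ → ℝ} (hv : ∀ p, p.Prime → Function.Periodic (v p) p)
    (d : ℕ) : Function.Periodic (primeProd v d) d := by
  intro t
  refine Finset.prod_congr rfl fun p hp => ?_
  obtain ⟨k, hk⟩ := Nat.dvd_of_mem_primeFactors hp
  have := (hv p (Nat.prime_of_mem_primeFactors hp)).nat_mul k
  rw [hk, mul_comm p k]
  exact this t

theorem abs_primeProd_le {v : ℕ → ℕ → ℝ} (hv : ∀ p, p.Prime → ∀ t, |v p t| ≤ 1) (d t : ℕ) :
    |primeProd v d t| ≤ 1 := by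
  rw [primeProd, Finset.abs_prod]
  exact Finset.prod_le_one (fun p _ => abs_nonneg _)
    fun p hp => hv p (Nat.prime_of_mem_primeFactors hp) t

theorem sum_primeProd_sq_le {v : ℕ → ℕ → ℝ} {g : ℕ → ℝ}
    (hper : ∀ p, p.Prime → Function.Periodic (v p) p)
    (hsq : ∀ p, p.Prime → ∑ t ∈ Finset.range p, v p t ^ 2 ≤ p * g p) (d : ℕ)
    (hd : Squarefree d) :
    ∑ t ∈ Finset.range d, primeProd v d t ^ 2 ≤ d * ∏ p ∈ d.primeFactors, g p := by
  induction d using Nat.strong_induction_on with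
  | _ d ih =>
    rcases eq_or_ne d 1 with rfl | h1
    · simp [primeProd]
    have hp := Nat.minFac_prime h1
    obtain ⟨e, he⟩ := Nat.minFac_dvd d
    set p := d.minFac
    have hcop : p.Coprime e := by
      rw [he] at hd
      exact Nat.coprime_of_squarefree_mul hd
    have hd0 : d ≠ 0 := hd.ne_zero
    have he0 : 0 < e := Nat.pos_of_ne_zero (by rintro rfl; simp [he] at hd0)
    have hlt : e < d := by
      rw [he]; exact lt_mul_of_one_lt_left he0 hp.one_lt
    have hde : Squarefree e := hd.squarefree_of_dvd ⟨p, by rw [he, mul_comm]⟩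
    have IH := ih e hlt hde
    clear_value p
    subst he
    simp_rw [primeProd_mul v hcop, mul_pow, primeProd_prime v hp]
    rw [sum_range_mul_of_coprime (f := fun t => v p t ^ 2) (h := fun t => primeProd v e t ^ 2)
      (fun t => by simp only [hper p hp t]) (fun t => by simp only [periodic_primeProd hper e t])
      hp.pos he0 hcop, hcop.primeFactors_mul, Finset.prod_union hcop.disjoint_primeFactors,
      hp.primeFactors, Finset.prod_singleton]
    push_cast
    calc _ ≤ (p * g p) * (e * ∏ p ∈ e.primeFactors, g p) :=
          mul_le_mul (hsq p hp) IH (Finset.sum_nonneg fun t _ => sq_nonneg _)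
            (le_trans (Finset.sum_nonneg fun t _ => sq_nonneg _) (hsq p hp))
      _ = _ := by ring

theorem abs_sum_primeProd_mul_le_of_prime {v : ℕ → ℕ → ℝ}
    (hper : ∀ p, p.Prime → Function.Periodic (v p) p)
    (hzero : ∀ p, p.Prime → ∑ t ∈ Finset.range p, v p t = 0)
    (hbd : ∀ p, p.Prime → ∀ t, |v p t| ≤ 1) {d e p : ℕ} (hd : Squarefree d) (he : e ≠ 0)
    (hp : p.Prime) (hpd : p ∣ d) (hpe : ¬ p ∣ e) (T : ℕ) :
    |∑ t ∈ Finset.range T, primeProd v d t * primeProd v e t| ≤ d * e := by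
  obtain ⟨c, rfl⟩ := hpd
  have hpc : p.Coprime c := Nat.coprime_of_squarefree_mul hd
  have hpe' : p.Coprime e := (Nat.Prime.coprime_iff_not_dvd hp).2 hpe
  have hc0 : 0 < c := Nat.pos_of_ne_zero (by rintro rfl; simp at hd)
  have he0 := Nat.pos_of_ne_zero he
  have hP1 : Function.Periodic (fun t => primeProd v c t * primeProd v e t) (c * e) := by
    intro t
    have h1 := (periodic_primeProd hper c).nat_mul e t
    have h2 := (periodic_primeProd hper e).nat_mul c t
    simp only [Nat.cast_id] at h1 h2
    rw [mul_comm e c] at h1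
    simp only [h1, h2]
  have heq : ∀ t, primeProd v (p * c) t * primeProd v e t =
      v p t * (primeProd v c t * primeProd v e t) := fun t => by
    rw [primeProd_mul v hpc, primeProd_prime v hp, mul_assoc]
  have hP : Function.Periodic (fun t => v p t * (primeProd v c t * primeProd v e t))
      (p * (c * e)) := by
    intro t
    have h1 := (hper p hp).nat_mul (c * e) t
    have h2 := hP1.nat_mul p t
    simp only [Nat.cast_id] at h1 h2
    rw [mul_comm (c * e) p] at h1
    simp only [h1, h2]
  simp_rw [heq]
  have := hP.abs_sum_range_le (by
      rw [sum_range_mul_of_coprime (hper p hp) hP1 hp.pos (by positivity)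
        (Nat.Coprime.mul_right hpc hpe'), hzero p hp, zero_mul])
    (fun t => by
      rw [abs_mul, abs_mul]
      exact mul_le_one₀ (hbd p hp t) (by positivity)
        (mul_le_one₀ (abs_primeProd_le hbd _ _) (abs_nonneg _) (abs_primeProd_le hbd _ _)))
    (Nat.mul_pos hp.pos (Nat.mul_pos hc0 he0)) T
  refine this.trans (le_of_eq ?_)
  push_cast; ring

theorem abs_sum_primeProd_mul_le {v : ℕ → ℕ → ℝ}
    (hper : ∀ p, p.Prime → Function.Periodic (v p) p)
    (hzero : ∀ p, p.Prime → ∑ t ∈ Finset.range p, v p t = 0)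
    (hbd : ∀ p, p.Prime → ∀ t, |v p t| ≤ 1) {d e : ℕ} (hd : Squarefree d) (he : Squarefree e)
    (hde : d ≠ e) (T : ℕ) :
    |∑ t ∈ Finset.range T, primeProd v d t * primeProd v e t| ≤ d * e := by
  have : ∃ p, p.Prime ∧ ¬ (p ∣ d ↔ p ∣ e) := by
    by_contra! h
    exact hde ((Nat.Squarefree.ext_iff hd he).2 h)
  obtain ⟨p, hp, hpde⟩ := this
  by_cases hpd : p ∣ d
  · exact abs_sum_primeProd_mul_le_of_prime hper hzero hbd hd he.ne_zero hp hpd (by tauto) T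
  · simp_rw [mul_comm (primeProd v d _), mul_comm (d : ℝ)]
    exact abs_sum_primeProd_mul_le_of_prime hper hzero hbd he hd.ne_zero hp (by tauto) hpd T

/-- The squarefree numbers up to `R`. -/
def squarefreeUpTo (R : ℕ) : Finset ℕ := (Finset.Icc 1 R).filter Squarefree

/-- An orthogonal form of Selberg's upper bound sieve. -/
theorem card_le_of_orthogonal_sieve {v : ℕ → ℕ → ℝ} {g : ℕ → ℝ}
    (hper : ∀ p, p.Prime → Function.Periodic (v p) p)
    (hzero : ∀ p, p.Prime → ∑ t ∈ Finset.range p, v p t = 0)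
    (hbd : ∀ p, p.Prime → ∀ t, |v p t| ≤ 1) (hg : ∀ p, p.Prime → 0 ≤ g p)
    (hsq : ∀ p, p.Prime → ∑ t ∈ Finset.range p, v p t ^ 2 ≤ p * g p)
    {R T : ℕ} (hR : 1 ≤ R) {A : Finset ℕ} (hAT : A ⊆ Finset.range T)
    (hA : ∀ t ∈ A, ∀ p, p.Prime → p ≤ R → v p t = g p) :
    (A.card : ℝ) ≤ T / (∑ d ∈ squarefreeUpTo R, ∏ p ∈ d.primeFactors, g p) + 2 * R ^ 4 := by
  set D := squarefreeUpTo R with hD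
  set γ : ℕ → ℝ := fun d => ∏ p ∈ d.primeFactors, g p with hγ
  set G := ∑ d ∈ D, γ d with hGdef
  have hmem : ∀ d ∈ D, 1 ≤ d ∧ d ≤ R ∧ Squarefree d := fun d hd => by
    simpa [hD, squarefreeUpTo, and_assoc] using hd
  have hγ0 : ∀ d, 0 ≤ γ d := fun d =>
    Finset.prod_nonneg fun p hp => hg p (Nat.prime_of_mem_primeFactors hp)
  have hG1 : 1 ≤ G := by
    have h1 : (1 : ℕ) ∈ D := by simp [hD, squarefreeUpTo, hR]
    have := Finset.single_le_sum (f := γ) (fun d _ => hγ0 d) h1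
    simpa [hγ] using this
  have hcard : (D.card : ℝ) ≤ R := by
    have : D.card ≤ (Finset.Icc 1 R).card := Finset.card_filter_le _ _
    rw [Nat.card_Icc, Nat.add_sub_cancel] at this
    exact_mod_cast this
  have hΛ : ∀ t ∈ A, ∑ d ∈ D, primeProd v d t = G := fun t ht =>
    Finset.sum_congr rfl fun d hd => Finset.prod_congr rfl fun p hp =>
      hA t ht p (Nat.prime_of_mem_primeFactors hp)
        ((Nat.le_of_mem_primeFactors hp).trans (hmem d hd).2.1)
  have h1 : A.card * G ^ 2 ≤ ∑ t ∈ Finset.range T, (∑ d ∈ D, primeProd v d t) ^ 2 := by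
    calc A.card * G ^ 2 = ∑ t ∈ A, (∑ d ∈ D, primeProd v d t) ^ 2 := by
          rw [Finset.sum_congr rfl fun t ht => by rw [hΛ t ht]]; simp
      _ ≤ _ := Finset.sum_le_sum_of_subset_of_nonneg hAT fun t _ _ => sq_nonneg _
  have h2 : ∑ t ∈ Finset.range T, (∑ d ∈ D, primeProd v d t) ^ 2 =
      ∑ d ∈ D, ∑ e ∈ D, ∑ t ∈ Finset.range T, primeProd v d t * primeProd v e t := by
    simp_rw [sq, Finset.sum_mul_sum]
    rw [Finset.sum_comm]
    exact Finset.sum_congr rfl fun d _ => Finset.sum_comm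
  have h3 : ∀ d ∈ D, ∀ e ∈ D, ∑ t ∈ Finset.range T, primeProd v d t * primeProd v e t ≤
      (if d = e then (T + R) * γ d else 0) + R ^ 2 := fun d hd e he => by
    obtain ⟨hd1, hdR, hds⟩ := hmem d hd
    obtain ⟨he1, heR, hes⟩ := hmem e he
    have hdR' : (d : ℝ) ≤ R := by exact_mod_cast hdR
    have heR' : (e : ℝ) ≤ R := by exact_mod_cast heR
    split_ifs with hde
    · subst hde
      have hper' : Function.Periodic (fun t => primeProd v d t ^ 2) d :=
        fun t => by simp only [periodic_primeProd hper d t]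
      have := hper'.sum_range_le (sum_primeProd_sq_le hper hsq d hds) (fun t => sq_nonneg _)
        (by omega) T
      simp_rw [← sq]
      calc _ ≤ ((T : ℝ) + d) * γ d := this
        _ ≤ (T + R) * γ d := by
          have := hγ0 d
          gcongr
        _ ≤ _ := by simp
    · have := abs_sum_primeProd_mul_le hper hzero hbd hds hes hde T
      calc _ ≤ (d : ℝ) * e := (le_abs_self _).trans this
        _ ≤ R * R := by gcongr
        _ = _ := by ring
  have h4 : A.card * G ^ 2 ≤ (T + R) * G + R ^ 4 := by
    calc A.card * G ^ 2 ≤ ∑ d ∈ D, ∑ e ∈ D, ((if d = e then (T + R) * γ d else 0) + (R : ℝ) ^ 2) := by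
          rw [h2] at h1
          exact h1.trans (Finset.sum_le_sum fun d hd => Finset.sum_le_sum fun e he => h3 d hd e he)
      _ = (T + R) * G + D.card * D.card * R ^ 2 := by
          simp only [Finset.sum_add_distrib, Finset.sum_ite_eq, Finset.sum_const, nsmul_eq_mul]
          rw [Finset.sum_congr rfl fun d hd => if_pos hd, ← Finset.mul_sum]
          ring
      _ ≤ (T + R) * G + R * R * R ^ 2 := by gcongr
      _ = _ := by ring
  have hR1 : (1 : ℝ) ≤ R := by exact_mod_cast hR
  have hRR : (R : ℝ) ≤ R ^ 4 := by
    calc (R : ℝ) = R ^ 1 := (pow_one _).symm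
      _ ≤ R ^ 4 := pow_le_pow_right₀ hR1 (by norm_num)
  have hGpos : 0 < G := by linarith
  have h5 : (A.card : ℝ) ≤ ((T + R) * G + R ^ 4) / G ^ 2 := by
    rw [le_div_iff₀ (by positivity)]; exact h4
  have h6 : ((T + R) * G + R ^ 4) / G ^ 2 = T / G + R / G + R ^ 4 / G ^ 2 := by
    field_simp
  have h7 : R / G ≤ (R : ℝ) := div_le_self (by positivity) hG1
  have h8 : (R : ℝ) ^ 4 / G ^ 2 ≤ R ^ 4 := div_le_self (by positivity) (one_le_pow₀ hG1)
  linarith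

theorem Finset.sum_le_sum_of_subset_image {α β : Type*} [DecidableEq β] {X : Finset α}
    {Y : Finset β} (π : α → β) (hY : Y ⊆ X.image π) {h : β → ℝ} (h0 : ∀ y, 0 ≤ h y) :
    ∑ y ∈ Y, h y ≤ ∑ x ∈ X, h (π x) := by
  calc ∑ y ∈ Y, h y ≤ ∑ y ∈ X.image π, h y :=
        Finset.sum_le_sum_of_subset_of_nonneg hY fun y _ _ => h0 y
    _ ≤ ∑ y ∈ X.image π, ∑ x ∈ X with π x = y, h (π x) := by
        refine Finset.sum_le_sum fun y hy => ?_
        obtain ⟨x, hx, rfl⟩ := Finset.mem_image.1 hy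
        exact Finset.single_le_sum (f := fun x => h (π x)) (fun x _ => h0 _)
          (Finset.mem_filter.2 ⟨hx, rfl⟩)
    _ = ∑ x ∈ X, h (π x) :=
        Finset.sum_fiberwise_of_maps_to (fun x hx => Finset.mem_image_of_mem π hx) _

theorem sum_Icc_inv_le_one_add_log (N : ℕ) : ∑ n ∈ Finset.Icc 1 N, (1 / n : ℝ) ≤ 1 + Real.log N := by
  have := harmonic_le_one_add_log N
  rw [harmonic_eq_sum_Icc] at this
  push_cast at this
  simpa using this

theorem log_le_sum_Icc_inv (N : ℕ) : Real.log N ≤ ∑ n ∈ Finset.Icc 1 N, (1 / n : ℝ) := by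
  rcases Nat.eq_zero_or_pos N with rfl | hN
  · simp
  have := log_add_one_le_harmonic N
  rw [harmonic_eq_sum_Icc] at this
  refine (Real.log_le_log (by positivity) ?_).trans (this.trans (by simp))
  push_cast; linarith

theorem sum_Icc_inv_sq_le_two (N : ℕ) : ∑ n ∈ Finset.Icc 1 N, (1 / n ^ 2 : ℝ) ≤ 2 := by
  rcases Nat.eq_zero_or_pos N with rfl | hN
  · simp
  suffices h : ∑ n ∈ Finset.Icc 1 N, (1 / n ^ 2 : ℝ) ≤ 2 - 1 / N by
    have : (0 : ℝ) ≤ 1 / N := by positivity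
    linarith
  induction N, hN using Nat.le_induction with
  | base => norm_num
  | succ n hn ih =>
    rw [Finset.sum_Icc_succ_top (by omega)]
    have hn' : (0 : ℝ) < n := by exact_mod_cast hn
    have : (1 / ((n + 1 : ℕ) : ℝ) ^ 2) ≤ 1 / n - 1 / ((n + 1 : ℕ) : ℝ) := by
      push_cast
      rw [div_sub_div _ _ hn'.ne' (by positivity), div_le_div_iff₀ (by positivity) (by positivity)]
      nlinarith
    linarith

/-- The squarefree numbers up to `N` coprime to `B`. -/
def squarefreeCoprime (N B : ℕ) : Finset ℕ := (squarefreeUpTo N).filter fun d => d.Coprime B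

theorem mem_squarefreeCoprime {N B d : ℕ} :
    d ∈ squarefreeCoprime N B ↔ 1 ≤ d ∧ d ≤ N ∧ Squarefree d ∧ d.Coprime B := by
  simp [squarefreeCoprime, squarefreeUpTo, and_assoc]

theorem log_le_sum_squarefreeCoprime (N : ℕ) {B : ℕ} (hB : 0 < B) :
    Real.log N ≤ 2 * (1 + Real.log B) * ∑ d ∈ squarefreeCoprime N B, (1 / d : ℝ) := by
  refine (log_le_sum_Icc_inv N).trans ?_
  have key := Finset.sum_le_sum_of_subset_image (Y := Finset.Icc 1 N)
    (X := Finset.Icc 1 N ×ˢ (Finset.Icc 1 B ×ˢ squarefreeCoprime N B))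
    (fun x : ℕ × ℕ × ℕ => x.1 ^ 2 * (x.2.1 * x.2.2)) (by
      intro n hn
      rw [Finset.mem_Icc] at hn
      obtain ⟨m, s, hms, hm⟩ := Nat.sq_mul_squarefree n
      have hn0 : 0 < n := hn.1
      have hm0 : 0 < m := Nat.pos_of_ne_zero hm.ne_zero
      have hs0 : 0 < s := Nat.pos_of_ne_zero (by rintro rfl; simp at hms; omega)
      have hmn : m ≤ n := by rw [← hms]; exact Nat.le_mul_of_pos_left _ (by positivity)
      have hsn : s ≤ n := by
        rw [← hms, sq, mul_assoc]; exact Nat.le_mul_of_pos_right _ (by positivity)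
      obtain ⟨d, hd⟩ := Nat.gcd_dvd_left m B
      have he0 : 0 < m.gcd B := Nat.gcd_pos_of_pos_left _ hm0
      have hd0 : 0 < d := Nat.pos_of_ne_zero (by rintro rfl; simp at hd; omega)
      refine Finset.mem_image.2 ⟨(s, m.gcd B, d), ?_, ?_⟩
      · simp only [Finset.mem_product, Finset.mem_Icc, mem_squarefreeCoprime]
        refine ⟨⟨hs0, hsn.trans hn.2⟩, ⟨he0, Nat.le_of_dvd hB (Nat.gcd_dvd_right _ _)⟩, hd0, ?_,
          hm.squarefree_of_dvd ⟨m.gcd B, by rw [mul_comm]; exact hd⟩, ?_⟩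
        · refine le_trans ?_ (hmn.trans hn.2)
          rw [hd]; exact Nat.le_mul_of_pos_left _ he0
        · have hcop : (m.gcd B).Coprime d := by
            rw [hd] at hm; exact Nat.coprime_of_squarefree_mul hm
          refine Nat.coprime_of_dvd fun q hq hqd hqB => ?_
          have hqm : q ∣ m := hqd.trans ⟨m.gcd B, by rw [mul_comm]; exact hd⟩
          exact Nat.not_coprime_of_dvd_of_dvd hq.one_lt (Nat.dvd_gcd hqm hqB) hqd hcop
      · simp only
        rw [← hd, hms]) (h := fun n => (1 / n : ℝ)) (fun n => by positivity)
  refine key.trans ?_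
  rw [Finset.sum_product]
  simp_rw [Finset.sum_product]
  have : ∀ s e d : ℕ, (1 / ((s ^ 2 * (e * d) : ℕ) : ℝ)) = 1 / s ^ 2 * (1 / e * (1 / d)) := by
    intro s e d; push_cast; simp only [one_div, mul_inv]
  simp_rw [this, ← Finset.mul_sum, ← Finset.sum_mul]
  have hL : 0 ≤ ∑ d ∈ squarefreeCoprime N B, (1 / d : ℝ) :=
    Finset.sum_nonneg fun _ _ => by positivity
  rw [mul_assoc]
  exact mul_le_mul (sum_Icc_inv_sq_le_two N)
    (mul_le_mul_of_nonneg_right (sum_Icc_inv_le_one_add_log B) hL)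
    (mul_nonneg (Finset.sum_nonneg fun _ _ => by positivity) hL) (by norm_num)

theorem sq_sum_squarefreeCoprime_le (N B : ℕ) :
    (∑ d ∈ squarefreeCoprime N B, (1 / d : ℝ)) ^ 2 ≤
      2 * ∑ D ∈ squarefreeCoprime (N ^ 2) B, (D.divisors.card / D : ℝ) := by
  rw [sq, Finset.sum_mul_sum, ← Finset.sum_product']
  have key := Finset.sum_le_sum_of_subset_image
    (Y := squarefreeCoprime N B ×ˢ squarefreeCoprime N B)
    (X := Finset.Icc 1 N ×ˢ (squarefreeCoprime (N ^ 2) B).sigma fun D => D.divisors)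
    (fun x : ℕ × (Σ _ : ℕ, ℕ) => (x.1 * x.2.2, x.1 * (x.2.1 / x.2.2))) (by
      rintro ⟨u, v⟩ huv
      simp only [Finset.mem_product, mem_squarefreeCoprime] at huv
      obtain ⟨⟨hu1, huN, hus, huB⟩, hv1, hvN, hvs, hvB⟩ := huv
      obtain ⟨c, u', v', hc, hcop, rfl, rfl⟩ := Nat.exists_coprime' (m := u) (n := v)
        (Nat.gcd_pos_of_pos_left v hu1)
      have hu' : 0 < u' := Nat.pos_of_ne_zero (by rintro rfl; simp at hu1)
      have hv' : 0 < v' := Nat.pos_of_ne_zero (by rintro rfl; simp at hv1)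
      refine Finset.mem_image.2 ⟨(c, ⟨u' * v', u'⟩), ?_, ?_⟩
      · simp only [Finset.mem_product, Finset.mem_Icc, Finset.mem_sigma, mem_squarefreeCoprime,
          Nat.mem_divisors]
        refine ⟨⟨hc, le_trans (Nat.le_mul_of_pos_left _ hu') huN⟩, ⟨Nat.mul_pos hu' hv', ?_, ?_, ?_⟩,
          dvd_mul_right _ _, (Nat.mul_pos hu' hv').ne'⟩
        · rw [sq]
          exact Nat.mul_le_mul (le_trans (Nat.le_mul_of_pos_right _ hc) huN)
            (le_trans (Nat.le_mul_of_pos_right _ hc) hvN)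
        · exact (Nat.squarefree_mul hcop).2 ⟨hus.squarefree_of_dvd (dvd_mul_right _ _),
            hvs.squarefree_of_dvd (dvd_mul_right _ _)⟩
        · exact Nat.Coprime.mul_left (Nat.Coprime.coprime_dvd_left (dvd_mul_right _ _) huB)
            (Nat.Coprime.coprime_dvd_left (dvd_mul_right _ _) hvB)
      · simp [Nat.mul_div_cancel_left _ hu', mul_comm])
    (h := fun x => (1 / x.1 * (1 / x.2) : ℝ)) (fun n => by positivity)
  refine key.trans ?_
  rw [Finset.sum_product]
  simp_rw [Finset.sum_sigma]
  have : ∀ c : ℕ, ∑ D ∈ squarefreeCoprime (N ^ 2) B, ∑ u ∈ D.divisors,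
      ((1 / ((c * u : ℕ) : ℝ)) * (1 / ((c * (D / u) : ℕ) : ℝ))) =
      (1 / c ^ 2) * ∑ D ∈ squarefreeCoprime (N ^ 2) B, (D.divisors.card / D : ℝ) := by
    intro c
    rw [Finset.mul_sum]
    refine Finset.sum_congr rfl fun D hD => ?_
    rw [Finset.sum_congr rfl (g := fun _ => (1 / c ^ 2 * (1 / D) : ℝ)), Finset.sum_const,
      nsmul_eq_mul]
    · ring
    · intro u hu
      obtain ⟨w, rfl⟩ := Nat.dvd_of_mem_divisors hu
      rw [Nat.mul_div_cancel_left _ (Nat.pos_of_mem_divisors hu)]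
      push_cast
      simp only [one_div, mul_inv, sq]
      ring
  simp_rw [this, ← Finset.sum_mul]
  exact mul_le_mul_of_nonneg_right (sum_Icc_inv_sq_le_two N)
    (Finset.sum_nonneg fun _ _ => by positivity)

/-- The sieve density of two residue classes modulo each prime not dividing `B`. -/
noncomputable def pairDensity (B p : ℕ) : ℝ := if p ∣ B then 0 else 2 / (p - 2)

theorem five_le_of_prime_of_not_dvd {B p : ℕ} (hB : 6 ∣ B) (hp : p.Prime) (hpB : ¬ p ∣ B) :
    5 ≤ p := by
  by_contra! h
  have h2 : 2 ∣ B := (by norm_num : 2 ∣ 6).trans hB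
  have h3 : 3 ∣ B := (by norm_num : 3 ∣ 6).trans hB
  have := hp.two_le
  interval_cases p
  · exact hpB h2
  · exact hpB h3
  · exact absurd hp (by norm_num)

theorem card_divisors_div_le_prod_pairDensity {B D : ℕ} (hB : 6 ∣ B) (hD : Squarefree D)
    (hDB : D.Coprime B) : (D.divisors.card / D : ℝ) ≤ ∏ p ∈ D.primeFactors, pairDensity B p := by
  have h1 : (D.divisors.card : ℝ) = ∏ p ∈ D.primeFactors, (2 : ℝ) := by
    rw [Nat.card_divisors hD.ne_zero]
    push_cast
    refine Finset.prod_congr rfl fun p hp => ?_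
    rw [Nat.factorization_eq_one_of_squarefree hD (Nat.prime_of_mem_primeFactors hp)
      (Nat.dvd_of_mem_primeFactors hp)]
    norm_num
  have h2 : (D : ℝ) = ∏ p ∈ D.primeFactors, (p : ℝ) := by
    rw [← Nat.cast_prod, Nat.prod_primeFactors_of_squarefree hD]
  rw [h1]
  conv_lhs => rw [h2]
  rw [← Finset.prod_div_distrib]
  refine Finset.prod_le_prod (fun p _ => by positivity) fun p hp => ?_
  have hpp := Nat.prime_of_mem_primeFactors hp
  have hpB : ¬ p ∣ B := fun h =>
    Nat.not_coprime_of_dvd_of_dvd hpp.one_lt (Nat.dvd_of_mem_primeFactors hp) h hDB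
  have h5 : (5 : ℝ) ≤ p := by exact_mod_cast five_le_of_prime_of_not_dvd hB hpp hpB
  rw [pairDensity, if_neg hpB]
  exact div_le_div_of_nonneg_left (by norm_num) (by linarith) (by linarith)

theorem pairDensity_nonneg {B p : ℕ} (hB : 6 ∣ B) (hp : p.Prime) : 0 ≤ pairDensity B p := by
  rw [pairDensity]
  split_ifs with h
  · rfl
  · have h5 : (5 : ℝ) ≤ p := by exact_mod_cast five_le_of_prime_of_not_dvd hB hp h
    exact div_nonneg (by norm_num) (by linarith)

theorem sq_log_le_sum_prod_pairDensity (N : ℕ) {B : ℕ} (hB : 0 < B) (h6 : 6 ∣ B) :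
    Real.log N ^ 2 ≤ 8 * (1 + Real.log B) ^ 2 *
      ∑ d ∈ squarefreeUpTo (N ^ 2), ∏ p ∈ d.primeFactors, pairDensity B p := by
  have h1 := log_le_sum_squarefreeCoprime N hB
  have h2 := sq_sum_squarefreeCoprime_le N B
  have h3 : ∑ D ∈ squarefreeCoprime (N ^ 2) B, (D.divisors.card / D : ℝ) ≤
      ∑ d ∈ squarefreeUpTo (N ^ 2), ∏ p ∈ d.primeFactors, pairDensity B p := by
    calc _ ≤ ∑ D ∈ squarefreeCoprime (N ^ 2) B, ∏ p ∈ D.primeFactors, pairDensity B p :=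
          Finset.sum_le_sum fun D hD => by
            obtain ⟨-, -, hs, hc⟩ := mem_squarefreeCoprime.1 hD
            exact card_divisors_div_le_prod_pairDensity h6 hs hc
      _ ≤ _ := Finset.sum_le_sum_of_subset_of_nonneg (Finset.filter_subset _ _) fun d _ _ =>
          Finset.prod_nonneg fun p hp =>
            pairDensity_nonneg h6 (Nat.prime_of_mem_primeFactors hp)
  have hlog : 0 ≤ Real.log N := Real.log_natCast_nonneg N
  calc Real.log N ^ 2 ≤ (2 * (1 + Real.log B) * ∑ d ∈ squarefreeCoprime N B, (1 / d : ℝ)) ^ 2 := by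
        gcongr
    _ = 4 * (1 + Real.log B) ^ 2 * (∑ d ∈ squarefreeCoprime N B, (1 / d : ℝ)) ^ 2 := by ring
    _ ≤ 4 * (1 + Real.log B) ^ 2 * (2 *
          ∑ d ∈ squarefreeUpTo (N ^ 2), ∏ p ∈ d.primeFactors, pairDensity B p) := by
        gcongr
        exact h2.trans (by gcongr)
    _ = _ := by ring

theorem sum_range_natCast_zmod (p : ℕ) [NeZero p] (F : ZMod p → ℝ) :
    ∑ t ∈ Finset.range p, F t = ∑ x, F x := by
  refine Finset.sum_bij (fun t _ => (t : ZMod p)) (fun _ _ => Finset.mem_univ _) ?_ ?_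
    fun _ _ => rfl
  · intro s hs t ht hst
    rw [ZMod.natCast_eq_natCast_iff] at hst
    exact hst.eq_of_lt_of_lt (Finset.mem_range.1 hs) (Finset.mem_range.1 ht)
  · intro x _
    exact ⟨x.val, Finset.mem_range.2 (ZMod.val_lt x), by simp⟩

open Classical in
/-- The sieve weight of the two residue classes `a * t = 1` and `b * t = 1` modulo `p`. -/
noncomputable def pairWeight (a b B p t : ℕ) : ℝ :=
  if p ∣ B then 0 else
    if (a * t : ZMod p) = 1 ∨ (b * t : ZMod p) = 1 then -1 else 2 / (p - 2)

theorem periodic_pairWeight (a b B p : ℕ) : Function.Periodic (pairWeight a b B p) p := by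
  intro t
  simp [pairWeight]

theorem abs_pairWeight_le {a b B p : ℕ} (h6 : 6 ∣ B) (hp : p.Prime) (t : ℕ) :
    |pairWeight a b B p t| ≤ 1 := by
  rw [pairWeight]
  split_ifs with h h'
  · simp
  · simp
  · have h5 : (5 : ℝ) ≤ p := by exact_mod_cast five_le_of_prime_of_not_dvd h6 hp h
    rw [abs_of_nonneg (div_nonneg (by norm_num) (by linarith)), div_le_one (by linarith)]
    linarith

theorem sum_pairWeight_comp {a b B p : ℕ} (hp : p.Prime) (hB : ¬ p ∣ B)
    (ha : (a : ZMod p) ≠ 0) (hb : (b : ZMod p) ≠ 0) (hab : (a : ZMod p) ≠ b) (φ : ℝ → ℝ) :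
    ∑ t ∈ Finset.range p, φ (pairWeight a b B p t) = 2 * φ (-1) + (p - 2) * φ (2 / (p - 2)) := by
  classical
  have := Fact.mk hp
  set F : ZMod p → ℝ := fun x => φ (2 / (p - 2)) +
      ((if x = (a : ZMod p)⁻¹ then φ (-1) - φ (2 / (p - 2)) else 0) +
      (if x = (b : ZMod p)⁻¹ then φ (-1) - φ (2 / (p - 2)) else 0)) with hFdef
  have hF : ∀ t : ℕ, φ (pairWeight a b B p t) = F t := fun t => by
    have e1 : (a * t : ZMod p) = 1 ↔ (t : ZMod p) = (a : ZMod p)⁻¹ := by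
      rw [mul_comm, mul_eq_one_iff_eq_inv₀ ha]
    have e2 : (b * t : ZMod p) = 1 ↔ (t : ZMod p) = (b : ZMod p)⁻¹ := by
      rw [mul_comm, mul_eq_one_iff_eq_inv₀ hb]
    have hne : (a : ZMod p)⁻¹ ≠ (b : ZMod p)⁻¹ := fun h => hab (inv_injective h)
    simp only [pairWeight, if_neg hB, e1, e2, hFdef]
    by_cases h1 : (t : ZMod p) = (a : ZMod p)⁻¹
    · rw [h1]; simp [hne]
    · by_cases h2 : (t : ZMod p) = (b : ZMod p)⁻¹
      · rw [h2]; simp [hne.symm]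
      · simp [h1, h2]
  rw [Finset.sum_congr rfl fun t _ => hF t, sum_range_natCast_zmod]
  simp only [hFdef, Finset.sum_add_distrib, Finset.sum_ite_eq', Finset.mem_univ, if_true,
    Finset.sum_const, Finset.card_univ, ZMod.card, nsmul_eq_mul]
  ring

theorem card_prime_pairs_le {a b : ℕ} (ha : 0 < a) (hb : 0 < b) (hab : a ≠ b) {N : ℕ}
    (hN : 2 ≤ N) (T : ℕ) :
    (((Finset.range T).filter fun t => (a * t - 1).Prime ∧ (b * t - 1).Prime).card : ℝ) ≤
      8 * (1 + Real.log (6 * (a * b * (max a b)))) ^ 2 * T / Real.log N ^ 2 + 5 * N ^ 8 := by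
  set B := 6 * (a * b * ((a : ℤ) - b).natAbs) with hBdef
  have hsub : 0 < ((a : ℤ) - b).natAbs := Int.natAbs_pos.2 (by omega)
  have hB : 0 < B := by positivity
  have h6 : 6 ∣ B := dvd_mul_right _ _
  have hp_facts : ∀ p : ℕ, ¬ p ∣ B → (a : ZMod p) ≠ 0 ∧ (b : ZMod p) ≠ 0 ∧ (a : ZMod p) ≠ b := by
    intro p hpB
    refine ⟨fun h => hpB ?_, fun h => hpB ?_, fun h => hpB ?_⟩
    · rw [ZMod.natCast_eq_zero_iff] at h
      exact Dvd.dvd.mul_left (Dvd.dvd.mul_right (Dvd.dvd.mul_right h _) _) _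
    · rw [ZMod.natCast_eq_zero_iff] at h
      exact Dvd.dvd.mul_left (Dvd.dvd.mul_right (Dvd.dvd.mul_left h _) _) _
    · have h' : (((a : ℤ) - b : ℤ) : ZMod p) = 0 := by push_cast; rw [h, sub_self]
      rw [ZMod.intCast_zmod_eq_zero_iff_dvd] at h'
      have : p ∣ ((a : ℤ) - b).natAbs := by simpa using Int.natAbs_dvd_natAbs.2 h'
      exact Dvd.dvd.mul_left (Dvd.dvd.mul_left this _) _
  have hcomp : ∀ p : ℕ, p.Prime → ¬ p ∣ B → ∀ φ : ℝ → ℝ,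
      ∑ t ∈ Finset.range p, φ (pairWeight a b B p t) =
        2 * φ (-1) + (p - 2) * φ (2 / (p - 2)) := fun p hp hpB φ =>
    sum_pairWeight_comp hp hpB (hp_facts p hpB).1 (hp_facts p hpB).2.1 (hp_facts p hpB).2.2 φ
  set R := N ^ 2 with hR
  set A := (Finset.range T).filter fun t => (a * t - 1).Prime ∧ (b * t - 1).Prime with hA
  set A' := A.filter fun t => R + 1 < t with hA'
  have hbig : (A.card : ℝ) ≤ A'.card + (R + 2) := by
    have h1 : A ⊆ A' ∪ Finset.range (R + 2) := fun t ht => by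
      rw [Finset.mem_union, Finset.mem_range, hA', Finset.mem_filter]
      by_cases h : R + 1 < t
      · exact Or.inl ⟨ht, h⟩
      · exact Or.inr (by omega)
    have h2 := (Finset.card_le_card h1).trans (Finset.card_union_le _ _)
    rw [Finset.card_range] at h2
    exact_mod_cast h2
  have hsieve := card_le_of_orthogonal_sieve (v := pairWeight a b B) (g := pairDensity B)
    (R := R) (T := T) (A := A') (fun p _ => periodic_pairWeight a b B p)
    (fun p hp => by
      by_cases hpB : p ∣ B
      · simp [pairWeight, hpB]
      · rw [hcomp p hp hpB (fun x => x)]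
        have h5 : (5 : ℝ) ≤ p := by exact_mod_cast five_le_of_prime_of_not_dvd h6 hp hpB
        have : (p : ℝ) - 2 ≠ 0 := by linarith
        field_simp; ring)
    (fun p hp t => abs_pairWeight_le h6 hp t) (fun p hp => pairDensity_nonneg h6 hp)
    (fun p hp => by
      by_cases hpB : p ∣ B
      · simp [pairWeight, pairDensity, hpB]
      · rw [hcomp p hp hpB (fun x => x ^ 2), pairDensity, if_neg hpB]
        have h5 : (5 : ℝ) ≤ p := by exact_mod_cast five_le_of_prime_of_not_dvd h6 hp hpB
        have : (p : ℝ) - 2 ≠ 0 := by linarith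
        refine le_of_eq ?_
        field_simp; ring)
    (Nat.one_le_pow _ _ (by omega))
    ((Finset.filter_subset _ _).trans (Finset.filter_subset _ _))
    (fun t ht p hp hpR => by
      simp only [hA', hA, Finset.mem_filter] at ht
      obtain ⟨⟨_, hat, hbt⟩, hRt⟩ := ht
      rw [pairWeight, pairDensity]
      split_ifs with h1 h2
      · rfl
      · exfalso
        have hdvd : ∀ c : ℕ, 0 < c → (c * t - 1).Prime → (c * t : ZMod p) ≠ 1 := by
          intro c hc hct h
          have hct1 : t ≤ c * t := Nat.le_mul_of_pos_left _ hc
          have : ((c * t - 1 : ℕ) : ZMod p) = 0 := by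
            rw [Nat.cast_sub (by omega)]; push_cast; rw [h]; simp
          rw [ZMod.natCast_eq_zero_iff, Nat.prime_dvd_prime_iff_eq hp hct] at this
          omega
        exact h2.elim (hdvd a ha hat) (hdvd b hb hbt)
      · rfl)
  set G := ∑ d ∈ squarefreeUpTo R, ∏ p ∈ d.primeFactors, pairDensity B p with hG
  have hGlow := sq_log_le_sum_prod_pairDensity N hB h6
  rw [← hR, ← hG] at hGlow
  have hlogN : 0 < Real.log N := Real.log_pos (by exact_mod_cast hN)
  have hBle : Real.log B ≤ Real.log (6 * (a * b * (max a b))) := by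
    refine Real.log_le_log (by exact_mod_cast hB) ?_
    have : ((a : ℤ) - b).natAbs ≤ max a b := by omega
    have : B ≤ 6 * (a * b * max a b) := by rw [hBdef]; gcongr
    exact_mod_cast this
  have hB0 : 0 ≤ Real.log B := Real.log_natCast_nonneg B
  have hGpos : 0 < G := by
    by_contra! h
    have : 8 * (1 + Real.log B) ^ 2 * G ≤ 0 := mul_nonpos_of_nonneg_of_nonpos (by positivity) h
    have : 0 < Real.log N ^ 2 := by positivity
    linarith
  have h1 : (T : ℝ) / G ≤ 8 * (1 + Real.log (6 * (a * b * (max a b)))) ^ 2 * T / Real.log N ^ 2 := by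
    rw [div_le_div_iff₀ hGpos (by positivity)]
    calc T * Real.log N ^ 2 ≤ T * (8 * (1 + Real.log B) ^ 2 * G) := by gcongr
      _ ≤ T * (8 * (1 + Real.log (6 * (a * b * (max a b)))) ^ 2 * G) := by gcongr
      _ = _ := by ring
  have hNR : ((R : ℕ) : ℝ) ^ 4 = N ^ 8 := by rw [hR]; push_cast; ring
  have hN2 : (2 : ℝ) ≤ N := by exact_mod_cast hN
  have hR2 : (R : ℝ) + 2 ≤ 3 * N ^ 8 := by
    have e1 : (R : ℝ) = N ^ 2 := by rw [hR]; push_cast; ring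
    have e2 : (N : ℝ) ^ 2 ≤ N ^ 8 := pow_le_pow_right₀ (by linarith) (by norm_num)
    have e3 : (1 : ℝ) ≤ N ^ 8 := one_le_pow₀ (by linarith)
    rw [e1]; linarith
  rw [hNR] at hsieve
  linarith

theorem Finset.sum_card_le_card_biUnion_add {ι α : Type*} [DecidableEq ι] [DecidableEq α]
    (s : Finset ι) (A : ι → Finset α) :
    ∑ i ∈ s, (A i).card ≤ (s.biUnion A).card +
      ∑ x ∈ s ×ˢ s with x.1 ≠ x.2, (A x.1 ∩ A x.2).card := by
  induction s using Finset.induction_on with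
  | empty => simp
  | insert i s hi ih =>
    rw [Finset.sum_insert hi, Finset.biUnion_insert]
    have h1 := Finset.card_union_add_card_inter (A i) (s.biUnion A)
    have h2 : (A i ∩ s.biUnion A).card ≤ ∑ j ∈ s, (A i ∩ A j).card := by
      rw [Finset.inter_biUnion]
      exact Finset.card_biUnion_le
    have h3 : ∑ j ∈ s, (A i ∩ A j).card + ∑ x ∈ s ×ˢ s with x.1 ≠ x.2, (A x.1 ∩ A x.2).card ≤
        ∑ x ∈ insert i s ×ˢ insert i s with x.1 ≠ x.2, (A x.1 ∩ A x.2).card := by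
      have e : ∑ j ∈ s, (A i ∩ A j).card = ∑ x ∈ s.map (Function.Embedding.sectR i ι),
          (A x.1 ∩ A x.2).card := by
        rw [Finset.sum_map]
        rfl
      rw [e, ← Finset.sum_union]
      · refine Finset.sum_le_sum_of_subset fun x hx => ?_
        simp only [Finset.mem_union, Finset.mem_map, Finset.mem_filter, Finset.mem_product,
          Finset.mem_insert, Function.Embedding.sectR_apply] at hx ⊢
        rcases hx with ⟨j, hj, rfl⟩ | ⟨⟨h1, h2⟩, h3⟩
        · exact ⟨⟨Or.inl rfl, Or.inr hj⟩, fun h => hi (by rwa [show i = j from h])⟩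
        · exact ⟨⟨Or.inr h1, Or.inr h2⟩, h3⟩
      · rw [Finset.disjoint_left]
        intro x hx hx'
        simp only [Finset.mem_map, Finset.mem_filter, Finset.mem_product,
          Function.Embedding.sectR_apply] at hx hx'
        obtain ⟨j, hj, rfl⟩ := hx
        exact hi hx'.1.1
    omega

theorem sum_gcd_div_mul_le (Y : ℕ) :
    ∑ x ∈ Finset.Icc 1 Y ×ˢ Finset.Icc 1 Y, ((x.1.gcd x.2 : ℕ) / (x.1 * x.2) : ℝ) ≤
      (1 + Real.log Y) ^ 3 := by
  have key := Finset.sum_le_sum_of_subset_image (Y := Finset.Icc 1 Y ×ˢ Finset.Icc 1 Y)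
    (X := (Finset.Icc 1 Y ×ˢ (Finset.Icc 1 Y ×ˢ Finset.Icc 1 Y)).filter
      fun x => x.2.1.Coprime x.2.2)
    (fun x : ℕ × ℕ × ℕ => (x.2.1 * x.1, x.2.2 * x.1)) (by
      rintro ⟨u, v⟩ huv
      simp only [Finset.mem_product, Finset.mem_Icc] at huv
      obtain ⟨⟨hu1, huN⟩, hv1, hvN⟩ := huv
      obtain ⟨c, u', v', hc, hcop, rfl, rfl⟩ := Nat.exists_coprime' (m := u) (n := v)
        (Nat.gcd_pos_of_pos_left v hu1)
      have hu' : 0 < u' := Nat.pos_of_ne_zero (by rintro rfl; simp at hu1)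
      have hv' : 0 < v' := Nat.pos_of_ne_zero (by rintro rfl; simp at hv1)
      refine Finset.mem_image.2 ⟨(c, u', v'), ?_, rfl⟩
      simp only [Finset.mem_filter, Finset.mem_product, Finset.mem_Icc]
      exact ⟨⟨⟨hc, le_trans (Nat.le_mul_of_pos_left _ hu') huN⟩,
        ⟨hu', le_trans (Nat.le_mul_of_pos_right _ hc) huN⟩,
        hv', le_trans (Nat.le_mul_of_pos_right _ hc) hvN⟩, hcop⟩)
    (h := fun x => ((x.1.gcd x.2 : ℕ) / (x.1 * x.2) : ℝ)) (fun n => by positivity)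
  refine key.trans ?_
  have hlog : 0 ≤ Real.log Y := Real.log_natCast_nonneg Y
  have hS := sum_Icc_inv_le_one_add_log Y
  have hS0 : (0 : ℝ) ≤ ∑ n ∈ Finset.Icc 1 Y, (1 / n : ℝ) := Finset.sum_nonneg fun _ _ => by positivity
  calc _ = ∑ x ∈ (Finset.Icc 1 Y ×ˢ (Finset.Icc 1 Y ×ˢ Finset.Icc 1 Y)).filter
        (fun x => x.2.1.Coprime x.2.2), ((1 / x.1) * (1 / x.2.1 * (1 / x.2.2)) : ℝ) := by
        refine Finset.sum_congr rfl fun x hx => ?_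
        simp only [Finset.mem_filter, Finset.mem_product, Finset.mem_Icc] at hx
        obtain ⟨⟨⟨hg, -⟩, ⟨ha, -⟩, hb, -⟩, hcop⟩ := hx
        rw [Nat.gcd_mul_right, hcop.gcd_eq_one]
        have h1 : (0 : ℝ) < x.1 := by exact_mod_cast hg
        have h2 : (0 : ℝ) < x.2.1 := by exact_mod_cast ha
        have h3 : (0 : ℝ) < x.2.2 := by exact_mod_cast hb
        push_cast
        field_simp
    _ ≤ ∑ x ∈ (Finset.Icc 1 Y ×ˢ (Finset.Icc 1 Y ×ˢ Finset.Icc 1 Y)),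
          ((1 / x.1) * (1 / x.2.1 * (1 / x.2.2)) : ℝ) :=
        Finset.sum_le_sum_of_subset_of_nonneg (Finset.filter_subset _ _) fun _ _ _ => by positivity
    _ = (∑ n ∈ Finset.Icc 1 Y, (1 / n : ℝ)) ^ 3 := by
        rw [Finset.sum_product]
        simp_rw [Finset.sum_product, ← Finset.mul_sum, ← Finset.sum_mul]
        ring
    _ ≤ _ := by gcongr

open Classical in
/-- The Hadamard orders in `[1, Y]`. -/
noncomputable def hadamardOrders (Y : ℕ) : Finset ℕ := (Finset.Icc 1 Y).filter HadamardOrder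

theorem mem_hadamardOrders {Y n : ℕ} : n ∈ hadamardOrders Y ↔ 1 ≤ n ∧ n ≤ Y ∧ HadamardOrder n := by
  simp [hadamardOrders, and_assoc]

theorem S_eq_card (x : ℝ) (hx : 0 ≤ x) : S x = (hadamardOrders ⌊x⌋₊).card := by
  rw [S, ← Set.ncard_coe_finset]
  congr 1
  ext n
  simp only [Set.mem_ofPred_eq, Finset.mem_coe, mem_hadamardOrders, Nat.le_floor_iff hx]
  rfl

/-- The sum of the reciprocals of the Hadamard orders in `[1, Y]`. -/
noncomputable def hadamardRecipSum (Y : ℕ) : ℝ := ∑ m ∈ hadamardOrders Y, (1 / m : ℝ)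

/-- The odd primes less than `K`. -/
def oddPrimesBelow (K : ℕ) : Finset ℕ := (Finset.range K).filter fun p => p.Prime ∧ p ≠ 2

/-- The numbers `2 * m * (p + 1) ≤ x` with `p` an odd prime. -/
noncomputable def shiftedPrimeMultiples (x : ℝ) (m : ℕ) : Finset ℕ :=
  (oddPrimesBelow ⌊x / (2 * m)⌋₊).image fun p => 2 * m * (p + 1)

theorem card_shiftedPrimeMultiples (x : ℝ) {m : ℕ} (hm : 0 < m) :
    (shiftedPrimeMultiples x m).card = (oddPrimesBelow ⌊x / (2 * m)⌋₊).card := by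
  refine Finset.card_image_of_injective _ fun p q h => ?_
  simpa [hm.ne'] using h

theorem shiftedPrimeMultiples_le {x : ℝ} {m n : ℕ} (hm : 0 < m)
    (hn : n ∈ shiftedPrimeMultiples x m) : 0 < n ∧ (n : ℝ) ≤ x := by
  simp only [shiftedPrimeMultiples, oddPrimesBelow, Finset.mem_image, Finset.mem_filter,
    Finset.mem_range] at hn
  obtain ⟨p, ⟨hp, -, -⟩, rfl⟩ := hn
  refine ⟨by positivity, ?_⟩
  have hm' : (0 : ℝ) < 2 * m := by positivity
  have h1 : ((p + 1 : ℕ) : ℝ) ≤ x / (2 * m) := (Nat.le_floor_iff' (Nat.succ_ne_zero p)).1 hp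
  rw [le_div_iff₀ hm'] at h1
  push_cast at h1 ⊢
  linarith

theorem biUnion_shiftedPrimeMultiples_subset {x : ℝ} (hx : 0 ≤ x) (Y : ℕ) :
    (hadamardOrders Y).biUnion (shiftedPrimeMultiples x) ⊆ hadamardOrders ⌊x⌋₊ := by
  intro n hn
  obtain ⟨m, hm, hnm⟩ := Finset.mem_biUnion.1 hn
  obtain ⟨hm1, -, hmH⟩ := mem_hadamardOrders.1 hm
  obtain ⟨hn0, hnx⟩ := shiftedPrimeMultiples_le hm1 hnm
  refine mem_hadamardOrders.2 ⟨hn0, (Nat.le_floor_iff hx).2 hnx, ?_⟩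
  simp only [shiftedPrimeMultiples, oddPrimesBelow, Finset.mem_image, Finset.mem_filter] at hnm
  obtain ⟨p, ⟨-, hp, hp2⟩, rfl⟩ := hnm
  have := Fact.mk hp
  rw [show 2 * m * (p + 1) = m * (2 * (p + 1)) by ring]
  exact hmH.mul (hadamardOrder_two_mul_prime_add_one p hp2)

theorem card_inter_shiftedPrimeMultiples_le {x : ℝ} (hx : 0 ≤ x) {m m' Y N : ℕ} (hm : 0 < m)
    (hm' : 0 < m') (hmY : m ≤ Y) (hmY' : m' ≤ Y) (hne : m ≠ m') (hN : 2 ≤ N) :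
    ((shiftedPrimeMultiples x m ∩ shiftedPrimeMultiples x m').card : ℝ) ≤
      8 * (1 + Real.log (6 * Y ^ 3)) ^ 2 / Real.log N ^ 2 *
        (x * ((m.gcd m' : ℕ) / (m * m')) + 1) + 5 * N ^ 8 := by
  obtain ⟨g, a, b, hg, hcop, rfl, rfl⟩ := Nat.exists_coprime' (m := m) (n := m')
    (Nat.gcd_pos_of_pos_left m' hm)
  have ha : 0 < a := Nat.pos_of_ne_zero (by rintro rfl; simp at hm)
  have hb : 0 < b := Nat.pos_of_ne_zero (by rintro rfl; simp at hm')
  have hab : a ≠ b := fun h => hne (by rw [h])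
  have haY : a ≤ Y := le_trans (Nat.le_mul_of_pos_right _ hg) hmY
  have hbY : b ≤ Y := le_trans (Nat.le_mul_of_pos_right _ hg) hmY'
  set T := ⌊x / (2 * g * a * b)⌋₊ + 1 with hT
  have hpos : (0 : ℝ) < 2 * g * a * b := by positivity
  have hsub : shiftedPrimeMultiples x (a * g) ∩ shiftedPrimeMultiples x (b * g) ⊆
      ((Finset.range T).filter fun t => (a * t - 1).Prime ∧ (b * t - 1).Prime).image
        fun t => 2 * g * a * b * t := by
    intro n hn
    obtain ⟨hn1, hn2⟩ := Finset.mem_inter.1 hn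
    obtain ⟨hn0, hnx⟩ := shiftedPrimeMultiples_le hm hn1
    simp only [shiftedPrimeMultiples, oddPrimesBelow, Finset.mem_image, Finset.mem_filter]
      at hn1 hn2
    obtain ⟨p, ⟨-, hp, -⟩, rfl⟩ := hn1
    obtain ⟨q, ⟨-, hq, -⟩, hpq⟩ := hn2
    have h1 : a * (p + 1) = b * (q + 1) := by
      have : (2 * g) * (a * (p + 1)) = (2 * g) * (b * (q + 1)) := by
        rw [show (2 * g) * (b * (q + 1)) = 2 * (b * g) * (q + 1) by ring, hpq]; ring
      exact Nat.eq_of_mul_eq_mul_left (by positivity) this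
    have h2 : b ∣ p + 1 := hcop.symm.dvd_of_dvd_mul_left ⟨q + 1, h1⟩
    obtain ⟨t, ht⟩ := h2
    have h3 : q + 1 = a * t := by
      rw [ht] at h1
      refine Nat.eq_of_mul_eq_mul_left hb ?_
      rw [← h1]; ring
    have h4 : 2 * (a * g) * (p + 1) = 2 * g * a * b * t := by rw [ht]; ring
    refine Finset.mem_image.2 ⟨t, Finset.mem_filter.2 ⟨?_, ?_, ?_⟩, h4.symm⟩
    · rw [Finset.mem_range, hT, Nat.lt_succ_iff]
      refine Nat.le_floor ?_
      rw [le_div_iff₀ hpos]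
      rw [h4] at hnx
      push_cast at hnx
      linarith
    · rw [← h3]; simpa using hq
    · rw [← ht]; simpa using hp
  have h1 := (Finset.card_le_card hsub).trans Finset.card_image_le
  have h2 := card_prime_pairs_le ha hb hab hN T
  have h3 : Real.log (6 * (a * b * (max a b))) ≤ Real.log (6 * Y ^ 3) := by
    refine Real.log_le_log (by positivity) ?_
    have : 6 * (a * b * max a b) ≤ 6 * Y ^ 3 := by
      rw [pow_three']
      gcongr
      exact max_le haY hbY
    exact_mod_cast this
  have h0 : 0 ≤ Real.log (6 * (a * b * (max a b))) := by
    have : 1 ≤ 6 * (a * b * max a b) := by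
      have : 0 < max a b := lt_max_of_lt_left ha
      exact Nat.succ_le_of_lt (by positivity)
    exact Real.log_nonneg (by exact_mod_cast this)
  have h4 : (T : ℝ) ≤ x * (((a * g).gcd (b * g) : ℕ) / ((a * g : ℕ) * (b * g : ℕ))) + 1 := by
    rw [Nat.gcd_mul_right, hcop.gcd_eq_one, hT]
    push_cast
    have e1 : (⌊x / (2 * g * a * b)⌋₊ : ℝ) ≤ x / (2 * g * a * b) := Nat.floor_le (by positivity)
    have e2 : x / (2 * g * a * b : ℝ) ≤ x * (1 * g / (a * g * (b * g))) := by
      have : (1 * g / (a * g * (b * g)) : ℝ) = 1 / (g * a * b) := by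
        have : (0 : ℝ) < g := by exact_mod_cast hg
        have : (0 : ℝ) < a := by exact_mod_cast ha
        have : (0 : ℝ) < b := by exact_mod_cast hb
        field_simp
      rw [this, div_eq_mul_one_div]
      have hg' : (0 : ℝ) < g * a * b := by positivity
      refine mul_le_mul_of_nonneg_left (one_div_le_one_div_of_le hg' (by nlinarith)) hx
    linarith
  calc _ ≤ (((Finset.range T).filter fun t => (a * t - 1).Prime ∧ (b * t - 1).Prime).card : ℝ) := by
        exact_mod_cast h1
    _ ≤ _ := h2
    _ = 8 * (1 + Real.log (6 * (a * b * (max a b)))) ^ 2 / Real.log N ^ 2 * T + 5 * N ^ 8 := by ring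
    _ ≤ _ := by gcongr

theorem sum_card_oddPrimesBelow_le {x : ℝ} (hx : 0 ≤ x) (Y : ℕ) {N : ℕ} (hN : 2 ≤ N) :
    ∑ m ∈ hadamardOrders Y, ((oddPrimesBelow ⌊x / (2 * m)⌋₊).card : ℝ) ≤ S x +
      (8 * (1 + Real.log (6 * Y ^ 3)) ^ 2 / Real.log N ^ 2 *
        (x * (1 + Real.log Y) ^ 3 + Y ^ 2) + 5 * N ^ 8 * Y ^ 2) := by
  classical
  set H := hadamardOrders Y with hH
  set κ := 8 * (1 + Real.log (6 * Y ^ 3)) ^ 2 / Real.log N ^ 2 with hκ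
  have hκ0 : 0 ≤ κ := by positivity
  have h1 := Finset.sum_card_le_card_biUnion_add H (shiftedPrimeMultiples x)
  have h2 := Finset.card_le_card (biUnion_shiftedPrimeMultiples_subset hx Y)
  rw [← S_eq_card x hx] at h2
  have h3 : ∑ m ∈ H, ((oddPrimesBelow ⌊x / (2 * m)⌋₊).card : ℝ) =
      ((∑ m ∈ H, (shiftedPrimeMultiples x m).card : ℕ) : ℝ) := by
    push_cast
    exact Finset.sum_congr rfl fun m hm => by
      rw [card_shiftedPrimeMultiples x (mem_hadamardOrders.1 hm).1]
  have h4 : ((∑ y ∈ H ×ˢ H with y.1 ≠ y.2,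
      (shiftedPrimeMultiples x y.1 ∩ shiftedPrimeMultiples x y.2).card : ℕ) : ℝ) ≤
      ∑ y ∈ Finset.Icc 1 Y ×ˢ Finset.Icc 1 Y,
        (κ * (x * ((y.1.gcd y.2 : ℕ) / (y.1 * y.2)) + 1) + 5 * N ^ 8) := by
    push_cast
    calc _ ≤ ∑ y ∈ H ×ˢ H with y.1 ≠ y.2,
          (κ * (x * ((y.1.gcd y.2 : ℕ) / (y.1 * y.2)) + 1) + 5 * N ^ 8) := by
          refine Finset.sum_le_sum fun y hy => ?_
          simp only [Finset.mem_filter, Finset.mem_product, hH, mem_hadamardOrders] at hy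
          obtain ⟨⟨⟨h1, h2, -⟩, h3, h4, -⟩, hne⟩ := hy
          exact card_inter_shiftedPrimeMultiples_le hx h1 h3 h2 h4 hne hN
      _ ≤ _ := by
          refine Finset.sum_le_sum_of_subset_of_nonneg ?_ fun y _ _ => by positivity
          exact (Finset.filter_subset _ _).trans
            (Finset.product_subset_product (Finset.filter_subset _ _) (Finset.filter_subset _ _))
  have h5 : ∑ y ∈ Finset.Icc 1 Y ×ˢ Finset.Icc 1 Y,
        (κ * (x * ((y.1.gcd y.2 : ℕ) / (y.1 * y.2)) + 1) + 5 * N ^ 8) ≤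
      κ * (x * (1 + Real.log Y) ^ 3 + Y ^ 2) + 5 * N ^ 8 * Y ^ 2 := by
    rw [Finset.sum_add_distrib, ← Finset.mul_sum, Finset.sum_add_distrib, ← Finset.mul_sum]
    simp only [Finset.sum_const, Finset.card_product, Nat.card_Icc, Nat.add_sub_cancel,
      nsmul_eq_mul]
    have := sum_gcd_div_mul_le Y
    push_cast
    have e : κ * (x * ∑ y ∈ Finset.Icc 1 Y ×ˢ Finset.Icc 1 Y,
        ((y.1.gcd y.2 : ℕ) / (y.1 * y.2) : ℝ) + Y * Y * 1) ≤
        κ * (x * (1 + Real.log Y) ^ 3 + Y ^ 2) := by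
      rw [mul_one, ← sq]
      gcongr
    linarith
  rw [h3]
  have h6 : ((∑ m ∈ H, (shiftedPrimeMultiples x m).card : ℕ) : ℝ) ≤ S x +
      ((∑ y ∈ H ×ˢ H with y.1 ≠ y.2,
        (shiftedPrimeMultiples x y.1 ∩ shiftedPrimeMultiples x y.2).card : ℕ) : ℝ) := by
    exact_mod_cast h1.trans (by gcongr)
  linarith

open Filter in
theorem div_log_le_card_oddPrimesBelow :
    ∀ᶠ K : ℕ in atTop, (K : ℝ) / (4 * Real.log K) ≤ ((oddPrimesBelow K).card : ℝ) := by
  have h1 : ∀ᶠ y : ℝ in atTop, Real.log y ≤ 1 / 10 * y := by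
    filter_upwards [Real.isLittleO_log_id_atTop.bound (show (0 : ℝ) < 1 / 10 by norm_num),
      eventually_ge_atTop 0] with y hy hy0
    simp only [id, Real.norm_eq_abs, abs_of_nonneg hy0] at hy
    exact (le_abs_self _).trans hy
  filter_upwards [tendsto_natCast_atTop_atTop.eventually h1,
    ((tendsto_natCast_atTop_atTop (R := ℝ)).atTop_add
      (tendsto_const_nhds (x := (1 : ℝ)))).eventually h1, eventually_ge_atTop 10] with K hK hK1 hK10
  have hK10' : (10 : ℝ) ≤ K := by exact_mod_cast hK10
  have hlog : 0 < Real.log K := Real.log_pos (by linarith)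
  have hpi := Chebyshev.pi_ge K
  have hcard : Nat.primeCounting K ≤ (oddPrimesBelow K).card + 2 := by
    rw [Nat.primeCounting, Nat.primeCounting', Nat.count_eq_card_filter_range]
    have : (Finset.range (K + 1)).filter Nat.Prime ⊆ oddPrimesBelow K ∪ {2, K} := by
      intro p hp
      simp only [oddPrimesBelow, Finset.mem_filter, Finset.mem_range, Finset.mem_union,
        Finset.mem_insert, Finset.mem_singleton] at hp ⊢
      have := hp.2
      by_cases h2 : p = 2
      · exact Or.inr (Or.inl h2)
      · by_cases h3 : p = K
        · exact Or.inr (Or.inr h3)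
        · exact Or.inl ⟨by omega, this, h2⟩
    exact (Finset.card_le_card this).trans ((Finset.card_union_le _ _).trans
      (Nat.add_le_add_left Finset.card_le_two _))
  have hcard' : (Nat.primeCounting K : ℝ) ≤ (oddPrimesBelow K).card + 2 := by exact_mod_cast hcard
  rw [div_le_iff₀ hlog] at hpi
  rw [div_le_iff₀ (by positivity)]
  have h2 := Real.log_two_gt_d9
  nlinarith [mul_le_mul_of_nonneg_right hcard' hlog.le]

theorem one_le_hadamardRecipSum {Y : ℕ} (hY : 1 ≤ Y) : 1 ≤ hadamardRecipSum Y := by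
  have h : 1 ∈ hadamardOrders Y := mem_hadamardOrders.2 ⟨le_rfl, hY, hadamardOrder_one⟩
  have := Finset.single_le_sum (f := fun m : ℕ => (1 / m : ℝ)) (fun _ _ => by positivity) h
  simpa [hadamardRecipSum] using this

open Filter in
theorem div_log_mul_recipSum_le_sum_card :
    ∃ K₀ : ℝ, ∀ (x : ℝ) (Y : ℕ), 0 < Y → K₀ ≤ x / Y →
      x / (16 * Real.log x) * hadamardRecipSum Y ≤
        ∑ m ∈ hadamardOrders Y, ((oddPrimesBelow ⌊x / (2 * m)⌋₊).card : ℝ) := by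
  obtain ⟨K₀, hK₀⟩ := eventually_atTop.1 div_log_le_card_oddPrimesBelow
  refine ⟨2 * (K₀ + 4), fun x Y hY hxY => ?_⟩
  rw [hadamardRecipSum, Finset.mul_sum]
  refine Finset.sum_le_sum fun m hm => ?_
  obtain ⟨hm1, hmY, -⟩ := mem_hadamardOrders.1 hm
  have hm1' : (1 : ℝ) ≤ m := by exact_mod_cast hm1
  have hmY' : (m : ℝ) ≤ Y := by exact_mod_cast hmY
  have hY' : (0 : ℝ) < Y := by exact_mod_cast hY
  have hx : 0 ≤ x := by
    rw [le_div_iff₀ hY'] at hxY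
    exact le_trans (by positivity) hxY
  have h1 : (K₀ : ℝ) + 4 ≤ x / (2 * m) := by
    have : x / Y ≤ x / m := by gcongr
    rw [show x / (2 * m) = x / m / 2 by field_simp]
    linarith
  have hfl := Nat.lt_floor_add_one (x / (2 * m))
  have hfl' := Nat.floor_le (show 0 ≤ x / (2 * m) by positivity)
  set K := ⌊x / (2 * m)⌋₊ with hKdef
  have hK0 : K₀ ≤ K := Nat.le_floor (by linarith)
  have hK3 : (3 : ℝ) ≤ K := by
    have : 3 ≤ K := Nat.le_floor (by push_cast; linarith [(Nat.cast_nonneg K₀ : (0 : ℝ) ≤ K₀)])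
    exact_mod_cast this
  refine le_trans ?_ (hK₀ K hK0)
  have hlogK : 0 < Real.log K := Real.log_pos (by linarith)
  have hKx : (K : ℝ) ≤ x := hfl'.trans (div_le_self hx (by linarith))
  have hlog : Real.log K ≤ Real.log x := Real.log_le_log (by linarith) hKx
  have hxm : x / (4 * m) ≤ K := by
    rw [show x / (4 * m) = x / (2 * m) / 2 by field_simp; norm_num]
    linarith
  calc x / (16 * Real.log x) * (1 / m) = (x / (4 * m)) / (4 * Real.log x) := by
        field_simp
        norm_num
    _ ≤ K / (4 * Real.log K) := by gcongr

open Filter in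
theorem exp_mul_recipSum_le_S :
    ∀ᶠ l : ℝ in atTop, 1 / 32 * (Real.exp (l ^ 10) / l ^ 10) * hadamardRecipSum ⌊Real.exp l⌋₊ ≤
      S (Real.exp (l ^ 10)) := by
  obtain ⟨K₀, hK₀⟩ := div_log_mul_recipSum_le_sum_card
  have hexp : ∀ᶠ L : ℝ in atTop, 320 * L ≤ Real.exp (L / 4) := by
    have h : ∀ᶠ y : ℝ in atTop, 1280 ≤ Real.exp y / y ^ 1 :=
      (Real.tendsto_exp_div_pow_atTop 1).eventually_ge_atTop 1280
    filter_upwards [(tendsto_id.atTop_div_const (show (0 : ℝ) < 4 by norm_num)).eventually h,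
      eventually_gt_atTop 0] with L hL hL0
    simp only [id, pow_one] at hL
    rw [le_div_iff₀ (by positivity)] at hL
    linarith
  filter_upwards [(tendsto_pow_atTop (by norm_num : (10 : ℕ) ≠ 0)).eventually hexp,
    eventually_ge_atTop (10 ^ 4),
    Real.tendsto_exp_atTop.eventually_ge_atTop K₀] with l hl320 hl hlK
  have hl0 : 0 < l := by linarith
  have hlL : 8 * l ≤ l ^ 10 := by
    have : (10 : ℝ) ^ 4 ≤ l ^ 9 := hl.trans (le_self_pow₀ (by linarith) (by norm_num))
    nlinarith
  have hC : 64 * (8 * 16 * 1024 * 9) ≤ l ^ 5 := by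
    calc (64 * (8 * 16 * 1024 * 9) : ℝ) ≤ (10 ^ 4) ^ 5 := by norm_num
      _ ≤ l ^ 5 := by gcongr
  set L := l ^ 10 with hL
  set Y := ⌊Real.exp l⌋₊ with hY
  have hL0 : 0 < L := by positivity
  have hYle : (Y : ℝ) ≤ Real.exp l := Nat.floor_le (Real.exp_pos l).le
  have hY1 : 1 ≤ Y := Nat.le_floor (by simpa using hl0.le)
  have hY1' : (1 : ℝ) ≤ Y := by exact_mod_cast hY1
  have hlogY : Real.log Y ≤ l := by
    rw [Real.log_le_iff_le_exp (by linarith)]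
    exact hYle
  have hlogY0 : 0 ≤ Real.log Y := Real.log_nonneg hY1'
  have hmain := hK₀ (Real.exp L) Y hY1 (hlK.trans (by
    rw [le_div_iff₀ (by linarith)]
    calc Real.exp l * Y ≤ Real.exp l * Real.exp l := by gcongr
      _ = Real.exp (l + l) := (Real.exp_add _ _).symm
      _ ≤ _ := Real.exp_le_exp.2 (by linarith)))
  set N := ⌊Real.exp (L / 16)⌋₊ with hN
  have hexpL : 2 ≤ Real.exp (L / 32) := by
    have := Real.add_one_le_exp (L / 32)
    linarith
  have hNle : (N : ℝ) ≤ Real.exp (L / 16) := Nat.floor_le (Real.exp_pos _).le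
  have hNge : Real.exp (L / 32) ≤ N := by
    have h1 := Nat.lt_floor_add_one (Real.exp (L / 16))
    have h2 : Real.exp (L / 16) = Real.exp (L / 32) * Real.exp (L / 32) := by
      rw [← Real.exp_add]
      ring_nf
    rw [← hN] at h1
    nlinarith
  have hN2 : 2 ≤ N := by
    have : (2 : ℝ) ≤ N := hexpL.trans hNge
    exact_mod_cast this
  have hlogN : L / 32 ≤ Real.log N := by
    rw [Real.le_log_iff_exp_le (by linarith)]
    exact hNge
  have hlogN0 : 0 < Real.log N := by linarith [show 0 < L / 32 by positivity]
  have hS := sum_card_oddPrimesBelow_le (Real.exp_pos L).le Y hN2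
  have hlog6 : 1 + Real.log (6 * Y ^ 3) ≤ 4 * l := by
    rw [Real.log_mul (by norm_num) (by positivity), Real.log_pow]
    have := Real.log_le_sub_one_of_pos (show (0 : ℝ) < 6 by norm_num)
    push_cast
    linarith
  have hlog60 : 0 ≤ 1 + Real.log (6 * Y ^ 3) := by
    have : 0 ≤ Real.log (6 * (Y : ℝ) ^ 3) := Real.log_nonneg (by
      have := one_le_pow₀ hY1' (n := 3)
      linarith)
    linarith
  have hY2 : (Y : ℝ) ^ 2 ≤ Real.exp (L / 4) := by
    calc (Y : ℝ) ^ 2 ≤ Real.exp l ^ 2 := by gcongr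
      _ = Real.exp (2 * l) := by rw [← Real.exp_nat_mul]; norm_num
      _ ≤ _ := Real.exp_le_exp.2 (by linarith)
  have herr1 : 8 * (1 + Real.log (6 * Y ^ 3)) ^ 2 / Real.log N ^ 2 *
      (Real.exp L * (1 + Real.log Y) ^ 3 + Y ^ 2) ≤ Real.exp L / (64 * L) := by
    calc _ ≤ 8 * (4 * l) ^ 2 / (L / 32) ^ 2 * (Real.exp L * (2 * l) ^ 3 + Real.exp L * l ^ 3) := by
          gcongr
          · linarith
          · calc (Y : ℝ) ^ 2 ≤ Real.exp (L / 4) := hY2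
              _ ≤ Real.exp L := Real.exp_le_exp.2 (by linarith)
              _ ≤ _ := le_mul_of_one_le_right (Real.exp_pos L).le (one_le_pow₀ (by linarith))
      _ = Real.exp L / (64 * L) * (64 * (8 * 16 * 1024 * 9) / l ^ 5) := by
          rw [hL]
          field_simp
          norm_num
      _ ≤ _ := mul_le_of_le_one_right (by positivity) ((div_le_one (by positivity)).2 hC)
  have herr2 : 5 * (N : ℝ) ^ 8 * Y ^ 2 ≤ Real.exp L / (64 * L) := by
    rw [le_div_iff₀ (by positivity)]
    calc 5 * (N : ℝ) ^ 8 * Y ^ 2 * (64 * L) ≤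
          5 * Real.exp (L / 16) ^ 8 * Real.exp (L / 4) * (64 * L) := by gcongr
      _ = Real.exp (L / 2) * Real.exp (L / 4) * (320 * L) := by
          rw [← Real.exp_nat_mul, show ((8 : ℕ) : ℝ) * (L / 16) = L / 2 by push_cast; ring]
          ring
      _ ≤ Real.exp (L / 2) * Real.exp (L / 4) * Real.exp (L / 4) := by gcongr
      _ = Real.exp L := by
          rw [← Real.exp_add, ← Real.exp_add]
          ring_nf
  have hW := one_le_hadamardRecipSum hY1
  rw [Real.log_exp] at hmain
  have hpos : 0 ≤ Real.exp L / L := by positivity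
  have e1 : Real.exp L / (64 * L) = 1 / 64 * (Real.exp L / L) := by field_simp
  have e2 : Real.exp L / (16 * L) = 1 / 16 * (Real.exp L / L) := by field_simp
  rw [e1] at herr1 herr2
  rw [e2] at hmain
  nlinarith [mul_le_mul_of_nonneg_left hW hpos]

theorem hadamardRecipSum_eq (Y : ℕ) :
    hadamardRecipSum Y = ∑ n ∈ Finset.Icc 1 Y, ((hadamardOrders n).card / (n * (n + 1)) : ℝ) +
      (hadamardOrders Y).card / (Y + 1) := by
  induction Y with
  | zero => simp [hadamardRecipSum, hadamardOrders]
  | succ Y ih =>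
    rw [Finset.sum_Icc_succ_top (by omega)]
    have hIcc : Finset.Icc 1 (Y + 1) = insert (Y + 1) (Finset.Icc 1 Y) := by
      ext n
      simp only [Finset.mem_Icc, Finset.mem_insert]
      omega
    by_cases h : HadamardOrder (Y + 1)
    · have e : hadamardOrders (Y + 1) = insert (Y + 1) (hadamardOrders Y) := by
        rw [hadamardOrders, hIcc, Finset.filter_insert, if_pos h]
        rfl
      have hn : Y + 1 ∉ hadamardOrders Y := by simp [mem_hadamardOrders]
      rw [hadamardRecipSum] at ih ⊢
      rw [e, Finset.sum_insert hn, Finset.card_insert_of_notMem hn, ih]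
      push_cast
      field_simp
      ring
    · have e : hadamardOrders (Y + 1) = hadamardOrders Y := by
        rw [hadamardOrders, hIcc, Finset.filter_insert, if_neg h]
        rfl
      rw [hadamardRecipSum] at ih ⊢
      rw [e, ih]
      push_cast
      field_simp
      ring

theorem sum_S_div_le_hadamardRecipSum (Y : ℕ) :
    ∑ n ∈ Finset.Icc 1 Y, ((S n : ℝ) / (n * (n + 1))) ≤ hadamardRecipSum Y := by
  rw [hadamardRecipSum_eq]
  refine le_add_of_le_of_nonneg (Finset.sum_le_sum fun n _ => ?_) (by positivity)
  rw [S_eq_card _ (Nat.cast_nonneg n), Nat.floor_natCast]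

theorem log_log_succ_sub_le {n : ℕ} (hn : 2 ≤ n) :
    Real.log (Real.log (n + 1)) - Real.log (Real.log n) ≤ 1 / (n * Real.log n) := by
  have hn' : (2 : ℝ) ≤ n := by exact_mod_cast hn
  have h0 : 0 < Real.log n := Real.log_pos (by linarith)
  have h1 : 0 < Real.log (n + 1) := Real.log_pos (by linarith)
  have h2 : Real.log (n + 1) - Real.log n ≤ 1 / n := by
    rw [← Real.log_div (by linarith) (by linarith)]
    refine (Real.log_le_sub_one_of_pos (by positivity)).trans_eq ?_
    field_simp
    ring
  rw [← Real.log_div h1.ne' h0.ne']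
  refine (Real.log_le_sub_one_of_pos (by positivity)).trans ?_
  rw [div_sub_one h0.ne', ← div_div]
  gcongr

theorem log_log_sub_log_log_le_sum {A Y : ℕ} (hA : 2 ≤ A) (hAY : A ≤ Y) :
    Real.log (Real.log (Y + 1)) - Real.log (Real.log A) ≤
      ∑ n ∈ Finset.Icc A Y, (1 / (n * Real.log n) : ℝ) := by
  induction Y, hAY using Nat.le_induction with
  | base => simpa using log_log_succ_sub_le hA
  | succ Y hY ih =>
    rw [Finset.sum_Icc_succ_top (by omega)]
    have := log_log_succ_sub_le (n := Y + 1) (by omega)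
    push_cast at this ⊢
    linarith

open Filter in
theorem exists_mul_log_pow_le_hadamardRecipSum {k : ℕ} {c : ℝ} (hc : 0 < c)
    (h : ∀ᶠ x : ℝ in atTop, c * (x / Real.log x) * Real.log (Real.log x) ^ k ≤ S x) :
    ∃ c' > 0, ∀ᶠ l : ℝ in atTop, c' * Real.log l ^ (k + 1) ≤ hadamardRecipSum ⌊Real.exp l⌋₊ := by
  obtain ⟨x₀, hx₀⟩ := eventually_atTop.1 h
  refine ⟨c / 2 * (1 / 2) ^ k * (1 / 4), by positivity, ?_⟩
  filter_upwards [Real.tendsto_log_atTop.eventually_ge_atTop 4, eventually_ge_atTop 16,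
    (Real.tendsto_exp_atTop.comp Real.tendsto_sqrt_atTop).eventually_ge_atTop x₀] with l hl hl16 hlx
  simp only [Function.comp] at hlx
  have hs : 4 ≤ √l := Real.le_sqrt_of_sq_le (by norm_num; exact hl16)
  have hsl : √l + 1 ≤ l := by nlinarith [Real.sq_sqrt (show 0 ≤ l by linarith)]
  have hes := Real.add_one_le_exp √l
  set A := ⌈Real.exp √l⌉₊ with hA
  set Y := ⌊Real.exp l⌋₊ with hY
  have hAge : Real.exp √l ≤ A := Nat.le_ceil _
  have hAle : (A : ℝ) < Real.exp √l + 1 := Nat.ceil_lt_add_one (Real.exp_pos _).le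
  have hA2 : 2 ≤ A := by
    have : (2 : ℝ) ≤ A := by linarith
    exact_mod_cast this
  have hlogA : Real.log A ≤ 2 * √l := by
    rw [Real.log_le_iff_le_exp (by linarith)]
    calc (A : ℝ) ≤ Real.exp √l * Real.exp √l := by nlinarith
      _ = _ := by rw [← Real.exp_add, two_mul]
  have hlogA' : √l ≤ Real.log A := by
    rw [Real.le_log_iff_exp_le (by linarith)]
    exact hAge
  have hAY : A ≤ Y := by
    refine Nat.le_floor ?_
    calc (A : ℝ) ≤ Real.exp √l * Real.exp 1 := by
          nlinarith [Real.add_one_le_exp (1 : ℝ)]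
      _ = Real.exp (√l + 1) := (Real.exp_add _ _).symm
      _ ≤ _ := Real.exp_le_exp.2 hsl
  have hlogY : l ≤ Real.log (Y + 1) := by
    rw [Real.le_log_iff_exp_le (by positivity)]
    exact (Nat.lt_floor_add_one _).le
  have hhalf : Real.log √l = Real.log l / 2 := Real.log_sqrt (by linarith)
  have hllA : Real.log (Real.log A) ≤ 1 + Real.log l / 2 := by
    calc Real.log (Real.log A) ≤ Real.log (2 * √l) := Real.log_le_log (by linarith) hlogA
      _ = Real.log 2 + Real.log l / 2 := by rw [Real.log_mul (by norm_num) (by linarith), hhalf]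
      _ ≤ _ := by linarith [Real.log_two_lt_d9]
  have hllY : Real.log l ≤ Real.log (Real.log (Y + 1)) := Real.log_le_log (by linarith) hlogY
  have hsum := log_log_sub_log_log_le_sum hA2 hAY
  refine le_trans ?_ (sum_S_div_le_hadamardRecipSum Y)
  calc c / 2 * (1 / 2) ^ k * (1 / 4) * Real.log l ^ (k + 1) =
        c / 2 * (Real.log l / 2) ^ k * (Real.log l / 4) := by
        rw [div_pow, pow_succ, div_pow, one_pow]
        ring
    _ ≤ c / 2 * (Real.log l / 2) ^ k * ∑ n ∈ Finset.Icc A Y, (1 / (n * Real.log n) : ℝ) := by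
        gcongr
        linarith
    _ = ∑ n ∈ Finset.Icc A Y, c / 2 * (Real.log l / 2) ^ k * (1 / (n * Real.log n) : ℝ) :=
        Finset.mul_sum _ _ _
    _ ≤ ∑ n ∈ Finset.Icc A Y, ((S n : ℝ) / (n * (n + 1))) := by
        refine Finset.sum_le_sum fun n hn => ?_
        have hAn : (A : ℝ) ≤ n := by exact_mod_cast (Finset.mem_Icc.1 hn).1
        have hlogn : √l ≤ Real.log n := hlogA'.trans (Real.log_le_log (by linarith) hAn)
        have hlln : Real.log l / 2 ≤ Real.log (Real.log n) := by
          rw [← hhalf]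
          exact Real.log_le_log (by linarith) hlogn
        have hn0 : (1 : ℝ) < n := by linarith
        have hlogn0 : 0 < Real.log n := by linarith
        rw [le_div_iff₀ (by positivity)]
        calc c / 2 * (Real.log l / 2) ^ k * (1 / (n * Real.log n)) * (n * (n + 1)) ≤
              c / 2 * (Real.log l / 2) ^ k * (1 / (n * Real.log n)) * (n * (2 * n)) := by
              gcongr
              linarith
          _ = c * (n / Real.log n) * (Real.log l / 2) ^ k := by
              field_simp
          _ ≤ c * (n / Real.log n) * Real.log (Real.log n) ^ k := by gcongr
          _ ≤ S n := hx₀ n (by linarith)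
    _ ≤ _ := Finset.sum_le_sum_of_subset_of_nonneg
        (Finset.Icc_subset_Icc_left (by omega)) fun _ _ _ => by positivity

open Filter in
theorem mul_recipSum_le_S :
    ∀ᶠ x : ℝ in atTop, 1 / 32 * (x / Real.log x) *
      hadamardRecipSum ⌊Real.exp (Real.log x ^ (1 / 10 : ℝ))⌋₊ ≤ S x := by
  have ht : Tendsto (fun x : ℝ => Real.log x ^ (1 / 10 : ℝ)) atTop atTop :=
    (tendsto_rpow_atTop (by norm_num)).comp Real.tendsto_log_atTop
  filter_upwards [ht.eventually exp_mul_recipSum_le_S, eventually_gt_atTop 1] with x hx hx1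
  have e : (Real.log x ^ (1 / 10 : ℝ)) ^ 10 = Real.log x := by
    rw [← Real.rpow_natCast, ← Real.rpow_mul (Real.log_pos hx1).le]
    norm_num
  rwa [e, Real.exp_log (by linarith)] at hx

open Filter in
theorem exists_mul_loglog_pow_le_S (k : ℕ) :
    ∃ c > 0, ∀ᶠ x : ℝ in atTop, c * (x / Real.log x) * Real.log (Real.log x) ^ k ≤ S x := by
  induction k with
  | zero =>
    refine ⟨1 / 32, by norm_num, ?_⟩
    filter_upwards [mul_recipSum_le_S, eventually_gt_atTop 1] with x hx hx1
    refine le_trans ?_ hx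
    have hlog := Real.log_pos hx1
    rw [pow_zero]
    gcongr
    exact one_le_hadamardRecipSum (Nat.le_floor (by simpa using Real.rpow_nonneg hlog.le _))
  | succ k ih =>
    obtain ⟨c, hc, h⟩ := ih
    obtain ⟨c', hc', h'⟩ := exists_mul_log_pow_le_hadamardRecipSum hc h
    have ht : Tendsto (fun x : ℝ => Real.log x ^ (1 / 10 : ℝ)) atTop atTop :=
      (tendsto_rpow_atTop (by norm_num)).comp Real.tendsto_log_atTop
    refine ⟨1 / 32 * (c' * (1 / 10) ^ (k + 1)), by positivity, ?_⟩
    filter_upwards [mul_recipSum_le_S, ht.eventually h', eventually_gt_atTop 1] with x hx hx' hx1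
    refine le_trans ?_ hx
    have hlog := Real.log_pos hx1
    rw [Real.log_rpow hlog, mul_pow] at hx'
    calc _ = 1 / 32 * (x / Real.log x) *
          (c' * ((1 / 10) ^ (k + 1) * Real.log (Real.log x) ^ (k + 1))) := by ring
      _ ≤ _ := by gcongr

theorem hadamard_count_loglog_power_lower :
    ∀ α : ℝ, α > 0 → ∀ ε : ℝ, ε > 0 → ∃ x₀ : ℝ, ∀ x : ℝ, x ≥ x₀ →
      (S x : ℝ) ≥ (1 - ε) * (x / Real.log x) * Real.log (Real.log x) ^ α := by
  intro α _ ε hε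
  obtain ⟨k, hk⟩ := exists_nat_gt α
  obtain ⟨c, hc, h⟩ := exists_mul_loglog_pow_le_S k
  refine Filter.eventually_atTop.1 ?_
  have hll : Filter.Tendsto (fun x : ℝ => Real.log (Real.log x)) Filter.atTop Filter.atTop :=
    Real.tendsto_log_atTop.comp Real.tendsto_log_atTop
  filter_upwards [h, hll.eventually ((tendsto_rpow_atTop (sub_pos.2 hk)).eventually_ge_atTop c⁻¹),
    hll.eventually_gt_atTop 0, Filter.eventually_gt_atTop 1] with x hx hxc hll0 hx1
  have hlog := Real.log_pos hx1
  refine le_trans ?_ hx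
  have e : Real.log (Real.log x) ^ k =
      Real.log (Real.log x) ^ ((k : ℝ) - α) * Real.log (Real.log x) ^ α := by
    rw [← Real.rpow_add hll0, sub_add_cancel, Real.rpow_natCast]
  rw [e]
  calc (1 - ε) * (x / Real.log x) * Real.log (Real.log x) ^ α ≤
        (c * c⁻¹) * (x / Real.log x) * Real.log (Real.log x) ^ α := by
        rw [mul_inv_cancel₀ hc.ne']
        gcongr
        linarith
    _ = c * (x / Real.log x) * (c⁻¹ * Real.log (Real.log x) ^ α) := by ring
    _ ≤ _ := by gcongr
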